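/- Let F : S^N → ℝ be uniformly elliptic with constants 0 < λ ≤ Λ and let h be Lipschitz continuous on B₁. Let (fₙ) and (Hₙ(·,0)) be sequences of continuous functions converging uniformly on every compact subset of B₁ to f_∞ and H_∞ respectively, and suppose there exist β₁, β₂ ∈ (0,1] and εₙ → 0 such that |Hₙ(x,q) − Hₙ(x,0)| ≤ εₙ(|q|^{β₁} + |q|^{β₂}) for all x ∈ B₁, q ∈ ℝ^N. Let (uₙ) be viscosity solutions of F(D²uₙ) + h(x)·∇uₙ + Hₙ(x,∇uₙ) = fₙ(x) in B₁ with (‖uₙ‖_∞) bounded. Then there is a subsequence of (uₙ) converging uniformly on every compact subset of B₁ to a function u_∞ which is a viscosity solution of F(D²u_∞) + h(x)·∇u_∞ + H_∞(x) = f_∞(x) in B₁. -/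

import Mathlib

open Metric Set Real
open scoped RealInnerProductSpace

noncomputable section

/-- `ℝ^N` with the euclidean structure. -/
abbrev Euc (N : ℕ) : Type := EuclideanSpace ℝ (Fin N)

/-- The Hessian matrix `D²φ(x)` of a function `φ` at a point `x`. -/
def hess {N : ℕ} (φ : Euc N → ℝ) (x : Euc N) : Matrix (Fin N) (Fin N) ℝ :=
  Matrix.of fun i j =>
    iteratedFDeriv ℝ 2 φ x ![EuclideanSpace.single i (1 : ℝ), EuclideanSpace.single j (1 : ℝ)]

/-- `F` is uniformly elliptic with ellipticity constants `lam ≤ Lam`: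
`lam * tr P ≤ F (M + P) - F M ≤ Lam * tr P` for symmetric `M` and positive semidefinite `P`. -/
def UnifElliptic {N : ℕ} (lam Lam : ℝ) (F : Matrix (Fin N) (Fin N) ℝ → ℝ) : Prop :=
  ∀ M P : Matrix (Fin N) (Fin N) ℝ, M.IsSymm → P.PosSemidef →
    lam * Matrix.trace P ≤ F (M + P) - F M ∧ F (M + P) - F M ≤ Lam * Matrix.trace P

/-- Standard viscosity subsolution of `G(x, ∇u, D²u) = f(x)` on `Ω`. -/
def ViscSub {N : ℕ} (Ω : Set (Euc N)) (G : Euc N → Euc N → Matrix (Fin N) (Fin N) ℝ → ℝ)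
    (f u : Euc N → ℝ) : Prop :=
  ∀ x₀ ∈ Ω, ∀ φ : Euc N → ℝ, ContDiff ℝ 2 φ →
    IsLocalMaxOn (fun x => u x - φ x) Ω x₀ →
    f x₀ ≤ G x₀ (gradient φ x₀) (hess φ x₀)

/-- Standard viscosity supersolution of `G(x, ∇u, D²u) = f(x)` on `Ω`. -/
def ViscSuper {N : ℕ} (Ω : Set (Euc N)) (G : Euc N → Euc N → Matrix (Fin N) (Fin N) ℝ → ℝ)
    (f u : Euc N → ℝ) : Prop :=
  ∀ x₀ ∈ Ω, ∀ φ : Euc N → ℝ, ContDiff ℝ 2 φ →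
    IsLocalMinOn (fun x => u x - φ x) Ω x₀ →
    G x₀ (gradient φ x₀) (hess φ x₀) ≤ f x₀

/-- Standard viscosity solution. -/
def ViscSol {N : ℕ} (Ω : Set (Euc N)) (G : Euc N → Euc N → Matrix (Fin N) (Fin N) ℝ → ℝ)
    (f u : Euc N → ℝ) : Prop :=
  ViscSub Ω G f u ∧ ViscSuper Ω G f u

/-- `u` is not constant on any neighbourhood of `x₀`. -/
def NotLocallyConst {N : ℕ} (u : Euc N → ℝ) (x₀ : Euc N) : Prop :=
  ∀ δ > 0, ∃ y ∈ ball x₀ δ, u y ≠ u x₀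

/-- Viscosity subsolution in the singular sense: test functions have nonvanishing gradient and
are only tested at points where `u` is not locally constant. -/
def ViscSubSing {N : ℕ} (Ω : Set (Euc N)) (G : Euc N → Euc N → Matrix (Fin N) (Fin N) ℝ → ℝ)
    (f u : Euc N → ℝ) : Prop :=
  ∀ x₀ ∈ Ω, NotLocallyConst u x₀ → ∀ φ : Euc N → ℝ, ContDiff ℝ 2 φ →
    gradient φ x₀ ≠ 0 → IsLocalMaxOn (fun x => u x - φ x) Ω x₀ →
    f x₀ ≤ G x₀ (gradient φ x₀) (hess φ x₀)

/-- Viscosity supersolution in the singular sense. -/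
def ViscSuperSing {N : ℕ} (Ω : Set (Euc N)) (G : Euc N → Euc N → Matrix (Fin N) (Fin N) ℝ → ℝ)
    (f u : Euc N → ℝ) : Prop :=
  ∀ x₀ ∈ Ω, NotLocallyConst u x₀ → ∀ φ : Euc N → ℝ, ContDiff ℝ 2 φ →
    gradient φ x₀ ≠ 0 → IsLocalMinOn (fun x => u x - φ x) Ω x₀ →
    G x₀ (gradient φ x₀) (hess φ x₀) ≤ f x₀

/-- Viscosity solution in the singular sense. -/
def ViscSolSing {N : ℕ} (Ω : Set (Euc N)) (G : Euc N → Euc N → Matrix (Fin N) (Fin N) ℝ → ℝ)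
    (f u : Euc N → ℝ) : Prop :=
  ViscSubSing Ω G f u ∧ ViscSuperSing Ω G f u

/-- Viscosity subsolution for the `α`-dependent notion: for `α = 0` it is the standard notion,
for `α ≠ 0` the singular one. -/
def ViscSubA {N : ℕ} (α : ℝ) (Ω : Set (Euc N))
    (G : Euc N → Euc N → Matrix (Fin N) (Fin N) ℝ → ℝ) (f u : Euc N → ℝ) : Prop :=
  ∀ x₀ ∈ Ω, ∀ φ : Euc N → ℝ, ContDiff ℝ 2 φ →
    IsLocalMaxOn (fun x => u x - φ x) Ω x₀ →
    (α = 0 ∨ (NotLocallyConst u x₀ ∧ gradient φ x₀ ≠ 0)) →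
    f x₀ ≤ G x₀ (gradient φ x₀) (hess φ x₀)

/-- Viscosity supersolution for the `α`-dependent notion. -/
def ViscSuperA {N : ℕ} (α : ℝ) (Ω : Set (Euc N))
    (G : Euc N → Euc N → Matrix (Fin N) (Fin N) ℝ → ℝ) (f u : Euc N → ℝ) : Prop :=
  ∀ x₀ ∈ Ω, ∀ φ : Euc N → ℝ, ContDiff ℝ 2 φ →
    IsLocalMinOn (fun x => u x - φ x) Ω x₀ →
    (α = 0 ∨ (NotLocallyConst u x₀ ∧ gradient φ x₀ ≠ 0)) →
    G x₀ (gradient φ x₀) (hess φ x₀) ≤ f x₀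

/-- Viscosity solution for the `α`-dependent notion. -/
def ViscSolA {N : ℕ} (α : ℝ) (Ω : Set (Euc N))
    (G : Euc N → Euc N → Matrix (Fin N) (Fin N) ℝ → ℝ) (f u : Euc N → ℝ) : Prop :=
  ViscSubA α Ω G f u ∧ ViscSuperA α Ω G f u

lemma exists_semiconvex_envelope {E : Type*} [NormedAddCommGroup E] [InnerProductSpace ℝ E]
    {D : Set E} (hD : IsCompact D) (hne : D.Nonempty) {u : E → ℝ} (hu : ContinuousOn u D) (a : ℝ) :
    ∃ (U : E → ℝ) (m : E → E), (∀ y, m y ∈ D) ∧ (∀ y, U y = u (m y) - a * ‖y - m y‖ ^ 2) ∧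
      ∀ y, ∀ x ∈ D, u x - a * ‖y - x‖ ^ 2 ≤ U y := by
  have h : ∀ y : E, ∃ x ∈ D, IsMaxOn (fun x => u x - a * ‖y - x‖ ^ 2) D x := fun y =>
    hD.exists_isMaxOn hne (hu.sub (by fun_prop))
  choose m hm hmax using h
  exact ⟨fun y => u (m y) - a * ‖y - m y‖ ^ 2, m, hm, fun y => rfl, fun y x hx => hmax y hx⟩

lemma norm_sq_affine_combination {E : Type*} [NormedAddCommGroup E] [InnerProductSpace ℝ E]
    (p y x : E) (t : ℝ) :
    ‖p + t • (y - p) - x‖ ^ 2 =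
      (1 - t) * ‖p - x‖ ^ 2 + t * ‖y - x‖ ^ 2 - t * (1 - t) * ‖y - p‖ ^ 2 := by
  have h1 : p + t • (y - p) - x = (p - x) + t • (y - p) := by abel
  have h2 : y - x = (p - x) + (y - p) := by abel
  rw [h1, h2, norm_add_sq_real, norm_add_sq_real, inner_smul_right, norm_smul, mul_pow,
    Real.norm_eq_abs, sq_abs]
  ring

/-- Quadratic growth at a minimum point of `U + 2a‖x - ·‖²`, when `U + a‖·‖²` is convex. -/
lemma exists_prox {E : Type*} [NormedAddCommGroup E] [InnerProductSpace ℝ E]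
    [FiniteDimensional ℝ E] {D : Set E} {u : E → ℝ} {a : ℝ} (ha : 0 < a) {U : E → ℝ} {m : E → E}
    (hm : ∀ y, m y ∈ D) (hU : ∀ y, U y = u (m y) - a * ‖y - m y‖ ^ 2)
    (hUle : ∀ y, ∀ x ∈ D, u x - a * ‖y - x‖ ^ 2 ≤ U y) (x : E) :
    ∃ p, ∀ y, U p + 2 * a * ‖x - p‖ ^ 2 + a * ‖y - p‖ ^ 2 ≤ U y + 2 * a * ‖x - y‖ ^ 2 := by
  have hlsc : LowerSemicontinuous fun y => U y + 2 * a * ‖x - y‖ ^ 2 := by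
    refine LowerSemicontinuous.add (fun y c hc => ?_) (Continuous.lowerSemicontinuous (by fun_prop))
    have hcont : Continuous fun z => u (m y) - a * ‖z - m y‖ ^ 2 := by fun_prop
    replace hc : c < u (m y) - a * ‖y - m y‖ ^ 2 := by rw [← hU y]; exact hc
    filter_upwards [hcont.continuousAt.eventually_const_lt hc] with z hz
    exact hz.trans_le (hUle z _ (hm y))
  obtain ⟨p, hp, hpmin⟩ := LowerSemicontinuousOn.exists_isMinOn
    (⟨x, mem_closedBall_self (by positivity)⟩ : (closedBall x (2 * ‖x - m x‖)).Nonempty)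
    (isCompact_closedBall x (2 * ‖x - m x‖)) (hlsc.lowerSemicontinuousOn _)
  have hmin : ∀ y, U p + 2 * a * ‖x - p‖ ^ 2 ≤ U y + 2 * a * ‖x - y‖ ^ 2 := by
    intro y
    by_cases hy : y ∈ closedBall x (2 * ‖x - m x‖)
    · exact hpmin hy
    · have h1 := hpmin (mem_closedBall_self (by positivity) : x ∈ closedBall x (2 * ‖x - m x‖))
      have h2 := hUle y _ (hm x)
      have h3 : ‖y - m x‖ ^ 2 = ‖x - m x‖ ^ 2 + 2 * ⟪x - m x, y - x⟫ + ‖x - y‖ ^ 2 := by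
        rw [← norm_neg (x - y), neg_sub, ← norm_add_sq_real]
        congr 2; abel
      have h4 : ⟪x - m x, y - x⟫ ≤ ‖x - m x‖ * ‖x - y‖ := by
        rw [← norm_neg (x - y), neg_sub]; exact real_inner_le_norm _ _
      have h5 : 2 * ‖x - m x‖ < ‖x - y‖ := by
        rw [mem_closedBall, not_le, dist_comm, dist_eq_norm] at hy; exact hy
      simp only [mem_ofPred_eq, sub_self, norm_zero] at h1
      have h6 := hU x
      have h7 : 0 ≤ a * (‖x - y‖ * (‖x - y‖ - 2 * ‖x - m x‖)) := by
        have := norm_nonneg (x - y)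
        have : 0 ≤ ‖x - y‖ - 2 * ‖x - m x‖ := by linarith
        positivity
      have h8 := mul_le_mul_of_nonneg_left h4 ha.le
      rw [h3] at h2
      nlinarith
  refine ⟨p, fun y => ?_⟩
  have key : ∀ t : ℝ, 0 < t → t < 1 →
      U p + 2 * a * ‖x - p‖ ^ 2 + a * ‖y - p‖ ^ 2 ≤
        U y + 2 * a * ‖x - y‖ ^ 2 + t * (a * ‖y - p‖ ^ 2) := by
    intro t ht0 ht1
    set z := p + t • (y - p) with hz
    have h1 := hmin z
    have h2 := hU z
    have h3 := mul_le_mul_of_nonneg_left (hUle p _ (hm z)) (sub_nonneg.2 ht1.le)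
    have h4 := mul_le_mul_of_nonneg_left (hUle y _ (hm z)) ht0.le
    have h5 := norm_sq_affine_combination p y (m z) t
    have h6 := norm_sq_affine_combination p y x t
    rw [← hz] at h5 h6
    rw [norm_sub_rev z x, norm_sub_rev p x, norm_sub_rev y x] at h6
    have h7 : t * (U p + 2 * a * ‖x - p‖ ^ 2 + a * ‖y - p‖ ^ 2) ≤
        t * (U y + 2 * a * ‖x - y‖ ^ 2 + t * (a * ‖y - p‖ ^ 2)) := by
      rw [h2, h5, h6] at h1
      linarith
    exact le_of_mul_le_mul_left h7 ht0
  have hcont : Filter.Tendsto (fun t : ℝ => U y + 2 * a * ‖x - y‖ ^ 2 + t * (a * ‖y - p‖ ^ 2))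
      (nhdsWithin 0 (Ioi 0)) (nhds (U y + 2 * a * ‖x - y‖ ^ 2 + 0 * (a * ‖y - p‖ ^ 2))) := by
    refine Filter.Tendsto.mono_left (Continuous.tendsto (by fun_prop) 0) nhdsWithin_le_nhds
  rw [zero_mul, add_zero] at hcont
  refine ge_of_tendsto hcont ?_
  filter_upwards [Ioo_mem_nhdsGT (zero_lt_one' ℝ)] with t ht
  exact key t ht.1 ht.2

/-- The Lasry–Lions regularization of a continuous function on a compact set: a `C^{1,1}` function,
close to the original one, whose points of one-sided second order contact from above are
translates of points of contact of the original function. -/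
lemma exists_lasry_lions_regularization {E : Type*} [NormedAddCommGroup E] [InnerProductSpace ℝ E]
    [FiniteDimensional ℝ E] {D : Set E} (hD : IsCompact D) (hne : D.Nonempty) {u : E → ℝ}
    (hu : ContinuousOn u D) {a : ℝ} (ha : 0 < a) :
    ∃ (W : E → ℝ) (G : E → E) (k : NNReal), LipschitzWith k G ∧
      (∀ x, HasGradientAt W (G x) x) ∧ (∀ x ∈ D, u x ≤ W x) ∧
      (∀ x, ∃ x' ∈ D, W x ≤ u x' - a * ‖x - x'‖ ^ 2) ∧
      ∀ x C, C < 2 * a →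
        (∀ᶠ z in nhds x, W z ≤ W x + ⟪G x, z - x⟫ + C * ‖z - x‖ ^ 2) →
        x + (4 * a)⁻¹ • G x ∈ D ∧ ∀ ξ, x + (4 * a)⁻¹ • G x + ξ ∈ D →
          u (x + (4 * a)⁻¹ • G x + ξ) - u (x + (4 * a)⁻¹ • G x) ≤ W (x + ξ) - W x := by
  obtain ⟨U, m, hm, hU, hUle⟩ := exists_semiconvex_envelope hD hne hu a
  choose P hP using exists_prox ha hm hU hUle
  set W : E → ℝ := fun x => U (P x) + 2 * a * ‖x - P x‖ ^ 2 with hW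
  set G : E → E := fun x => (4 * a) • (x - P x) with hG
  have hWle : ∀ x y, W x ≤ U y + 2 * a * ‖x - y‖ ^ 2 := fun x y => by
    have := hP x y
    have h2 : 0 ≤ a * ‖y - P x‖ ^ 2 := by positivity
    simp only [hW]; linarith
  have hPlip : ∀ x y, ‖P x - P y‖ ≤ 2 * ‖x - y‖ := by
    intro x y
    have h1 := hP x (P y)
    have h2 := hP y (P x)
    have e1 : ‖x - P y‖ ^ 2 = ‖x - P x‖ ^ 2 + 2 * ⟪x - P x, P x - P y⟫ + ‖P x - P y‖ ^ 2 := by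
      rw [← norm_add_sq_real]; congr 2; abel
    have e2 : ‖y - P x‖ ^ 2 = ‖y - P y‖ ^ 2 - 2 * ⟪y - P y, P x - P y⟫ + ‖P x - P y‖ ^ 2 := by
      rw [← norm_sub_sq_real]; congr 2; abel
    have e3 : ⟪x - y, P x - P y⟫ = ⟪x - P x, P x - P y⟫ - ⟪y - P y, P x - P y⟫
        + ‖P x - P y‖ ^ 2 := by
      rw [← real_inner_self_eq_norm_sq, ← inner_sub_left, ← inner_add_left]; congr 1; abel
    have e4 : ‖P y - P x‖ = ‖P x - P y‖ := norm_sub_rev _ _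
    have h3 := real_inner_le_norm (x - y) (P x - P y)
    rw [e4, e1] at h1
    rw [e2] at h2
    have h4 : a * ‖P x - P y‖ ^ 2 ≤ a * (2 * (‖x - y‖ * ‖P x - P y‖)) := by
      have := mul_le_mul_of_nonneg_left h3 ha.le
      rw [e3] at this
      nlinarith
    have h5 := le_of_mul_le_mul_left h4 ha
    by_contra hcon
    push Not at hcon
    have := norm_nonneg (x - y)
    nlinarith
  have hGlip : ∀ x y, ‖G x - G y‖ ≤ 12 * a * ‖x - y‖ := by
    intro x y
    have e : G x - G y = (4 * a) • ((x - y) - (P x - P y)) := by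
      simp only [hG]; rw [← smul_sub]; congr 1; abel
    rw [e, norm_smul, Real.norm_of_nonneg (by positivity)]
    have := norm_sub_le (x - y) (P x - P y)
    have := hPlip x y
    nlinarith
  have hupper : ∀ x z, W z ≤ W x + ⟪G x, z - x⟫ + 2 * a * ‖z - x‖ ^ 2 := by
    intro x z
    have h1 := hWle z (P x)
    have e1 : ‖z - P x‖ ^ 2 = ‖x - P x‖ ^ 2 + 2 * ⟪x - P x, z - x⟫ + ‖z - x‖ ^ 2 := by
      rw [← norm_add_sq_real]; congr 2; abel
    have e2 : ⟪G x, z - x⟫ = 4 * a * ⟪x - P x, z - x⟫ := by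
      simp only [hG, real_inner_smul_left]
    rw [e1] at h1
    rw [e2]
    simp only [hW] at h1 ⊢
    linarith
  have hlower : ∀ x z, W x + ⟪G x, z - x⟫ - 14 * a * ‖z - x‖ ^ 2 ≤ W z := by
    intro x z
    have h1 := hupper z x
    have e1 : ⟪G z, x - z⟫ = -⟪G x, z - x⟫ - ⟪G z - G x, z - x⟫ := by
      rw [← neg_sub z x, inner_neg_right, inner_sub_left]; ring
    have h2 := abs_le.1 (abs_real_inner_le_norm (G z - G x) (z - x))
    have h3 := mul_le_mul_of_nonneg_right (hGlip z x) (norm_nonneg (z - x))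
    rw [e1, norm_sub_rev x z] at h1
    nlinarith [h2.1]
  refine ⟨W, G, ⟨12 * a, by positivity⟩, ?_, ?_, ?_, ?_, ?_⟩
  · exact LipschitzWith.of_dist_le_mul fun x y => by
      rw [dist_eq_norm, dist_eq_norm]; exact hGlip x y
  · intro x
    rw [hasGradientAt_iff_isLittleO]
    refine Asymptotics.IsBigO.trans_isLittleO (g := fun z => ‖z - x‖ ^ 2) ?_ ?_
    · refine Asymptotics.IsBigO.of_bound (14 * a) (Filter.Eventually.of_forall fun z => ?_)
      rw [Real.norm_eq_abs, Real.norm_of_nonneg (by positivity), abs_le]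
      have h1 := hupper x z
      have h2 := hlower x z
      have h3 : 0 ≤ a * ‖z - x‖ ^ 2 := by positivity
      constructor <;> linarith
    · have := (Asymptotics.isLittleO_norm_pow_id (E' := E) one_lt_two).comp_tendsto
        (show Filter.Tendsto (fun z => z - x) (nhds x) (nhds 0) from
          (continuous_id.sub continuous_const).tendsto' _ _ (by simp))
      exact this
  · intro x hx
    have h1 := hUle (P x) x hx
    rw [norm_sub_rev] at h1
    have : 0 ≤ a * ‖x - P x‖ ^ 2 := by positivity
    simp only [hW]; linarith
  · intro x
    refine ⟨m x, hm x, ?_⟩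
    have := hWle x x
    simpa [hU x] using this
  · intro x C hC hcontact
    set d : E := x - P x with hd
    have hGx : G x = (4 * a) • d := rfl
    have hxs : x + (4 * a)⁻¹ • G x = P x + (2 : ℝ) • d := by
      rw [hGx, smul_smul, inv_mul_cancel₀ (by positivity), hd]; module
    -- `m (P x)` lies on the line through `P x` and `x`
    set v : E := (2⁻¹ : ℝ) • (m (P x) - P x) - d with hv
    have hline : ∀ t ∈ Icc (0 : ℝ) 1,
        W x + t * ⟪G x, v⟫ + 2 * a * t ^ 2 * ‖v‖ ^ 2 ≤ W (x + t • v) := by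
      intro t ht
      set y := P (x + t • v) with hy
      have g1 := hP x y
      have g2 := hUle y _ (hm (P x))
      have g3 := hU (P x)
      have hWt : W (x + t • v) = U y + 2 * a * ‖x + t • v - y‖ ^ 2 := rfl
      set ρ : E := y - P x with hρ
      have em : m (P x) - P x = (2 : ℝ) • (v + d) := by
        rw [hv, sub_add_cancel, smul_smul]; norm_num
      have e1 : ‖x - y‖ ^ 2 = ‖d‖ ^ 2 - 2 * ⟪d, ρ⟫ + ‖ρ‖ ^ 2 := by
        rw [← norm_sub_sq_real]; congr 2; rw [hd, hρ]; abel
      have e2 : ‖y - m (P x)‖ ^ 2 = ‖ρ‖ ^ 2 - 4 * ⟪v, ρ⟫ - 4 * ⟪d, ρ⟫ + 4 * ‖v + d‖ ^ 2 := by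
        have : y - m (P x) = ρ - (2 : ℝ) • (v + d) := by rw [← em, hρ]; abel
        rw [this, norm_sub_sq_real, inner_smul_right, norm_smul, inner_add_right,
          real_inner_comm, real_inner_comm d ρ]
        norm_num
        ring
      have e3 : ‖P x - m (P x)‖ ^ 2 = 4 * ‖v + d‖ ^ 2 := by
        rw [norm_sub_rev, em, norm_smul]; norm_num; ring
      have e4 : ‖x + t • v - y‖ ^ 2 = ‖d‖ ^ 2 + t ^ 2 * ‖v‖ ^ 2 + ‖ρ‖ ^ 2 + 2 * t * ⟪d, v⟫
          - 2 * ⟪d, ρ⟫ - 2 * t * ⟪v, ρ⟫ := by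
        have : x + t • v - y = d + t • v - ρ := by rw [hd, hρ]; abel
        rw [this, norm_sub_sq_real, norm_add_sq_real, inner_add_left, inner_smul_left,
          inner_smul_right, norm_smul, mul_pow, Real.norm_eq_abs, sq_abs]
        simp
        ring
      have e5 : ⟪G x, v⟫ = 4 * a * ⟪d, v⟫ := by rw [hGx, real_inner_smul_left]
      have hWx : W x = U (P x) + 2 * a * ‖d‖ ^ 2 := rfl
      rw [e1] at g1
      rw [e2] at g2
      rw [e3] at g3
      rw [hWt, e4, e5, hWx]
      have g4 : U (P x) + 4 * a * ⟪d, ρ⟫ - a * ‖ρ‖ ^ 2 ≤ U y := by linarith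
      have g5 : U (P x) + 4 * a * ⟪v, ρ⟫ + 4 * a * ⟪d, ρ⟫ - a * ‖ρ‖ ^ 2 ≤ U y := by linarith
      have g6 := mul_le_mul_of_nonneg_left g4 (sub_nonneg.2 ht.2)
      have g7 := mul_le_mul_of_nonneg_left g5 ht.1
      have g8 : 0 ≤ a * ‖ρ‖ ^ 2 := by positivity
      linarith
    have hv0 : v = 0 := by
      have ht : Filter.Tendsto (fun t : ℝ => x + t • v) (nhdsWithin 0 (Ioi 0)) (nhds x) :=
        (Continuous.tendsto' (by fun_prop) _ _ (by simp)).mono_left nhdsWithin_le_nhds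
      obtain ⟨t, h1, h2⟩ := ((ht.eventually hcontact).and
        (Ioo_mem_nhdsGT (zero_lt_one' ℝ))).exists
      have h3 := hline t ⟨h2.1.le, h2.2.le⟩
      rw [add_sub_cancel_left, inner_smul_right, norm_smul, mul_pow, Real.norm_eq_abs,
        sq_abs] at h1
      have h4 : 0 < t ^ 2 * (2 * a - C) := mul_pos (pow_pos h2.1 2) (by linarith)
      have h5 : t ^ 2 * (2 * a - C) * ‖v‖ ^ 2 ≤ 0 := by linarith
      have h6 : ‖v‖ ^ 2 ≤ 0 := by
        by_contra hcon
        push Not at hcon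
        have := mul_pos h4 hcon
        linarith
      have h7 : ‖v‖ = 0 := by nlinarith [norm_nonneg v]
      exact norm_eq_zero.1 h7
    have hm2 : m (P x) = P x + (2 : ℝ) • d := by
      have : m (P x) - P x = (2 : ℝ) • (v + d) := by
        rw [hv, sub_add_cancel, smul_smul]; norm_num
      rw [hv0, zero_add] at this
      rw [← this]; abel
    rw [hxs, ← hm2]
    refine ⟨hm _, fun ξ hξ => ?_⟩
    have h1 := hUle (P (x + ξ)) _ hξ
    have h2 := hU (P x)
    set ρ : E := ξ - (P (x + ξ) - P x) with hρ
    have e1 : ‖P (x + ξ) - (m (P x) + ξ)‖ ^ 2 = 4 * ‖d‖ ^ 2 + 4 * ⟪d, ρ⟫ + ‖ρ‖ ^ 2 := by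
      have : P (x + ξ) - (m (P x) + ξ) = -((2 : ℝ) • d + ρ) := by rw [hm2, hρ]; abel
      rw [this, norm_neg, norm_add_sq_real, real_inner_smul_left, norm_smul]
      norm_num; ring
    have e2 : ‖P x - m (P x)‖ ^ 2 = 4 * ‖d‖ ^ 2 := by
      have : P x - m (P x) = -((2 : ℝ) • d) := by rw [hm2]; abel
      rw [this, norm_neg, norm_smul]
      norm_num; ring
    have e3 : W (x + ξ) = U (P (x + ξ)) + 2 * a * (‖d‖ ^ 2 + 2 * ⟪d, ρ⟫ + ‖ρ‖ ^ 2) := by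
      have : x + ξ - P (x + ξ) = d + ρ := by rw [hd, hρ]; abel
      simp only [hW]
      rw [this, norm_add_sq_real]
    have e4 : W x = U (P x) + 2 * a * ‖d‖ ^ 2 := rfl
    rw [e1] at h1
    rw [e2] at h2
    rw [e3, e4]
    have : 0 ≤ a * ‖ρ‖ ^ 2 := by positivity
    linarith

/-- Second order Taylor expansion at a point of differentiability of the gradient. -/
lemma taylor_two_of_hasGradientAt {E : Type*} [NormedAddCommGroup E] [InnerProductSpace ℝ E]
    [CompleteSpace E] {W : E → ℝ} {G : E → E} (hW : ∀ x, HasGradientAt W (G x) x) {x : E}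
    {X : E →L[ℝ] E} (hX : HasFDerivAt G X x) :
    (∀ v w, ⟪X v, w⟫ = ⟪v, X w⟫) ∧
      ∀ η > 0, ∀ᶠ ξ in nhds (0 : E),
        |W (x + ξ) - W x - ⟪G x, ξ⟫ - 2⁻¹ * ⟪X ξ, ξ⟫| ≤ η * ‖ξ‖ ^ 2 := by
  have hsymm : ∀ v w, ⟪X v, w⟫ = ⟪v, X w⟫ := by
    intro v w
    have h1 : HasFDerivAt (fun y => innerSL ℝ (G y)) ((innerSL ℝ).comp X) x :=
      ((innerSL ℝ : E →L[ℝ] E →L[ℝ] ℝ).hasFDerivAt).comp x hX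
    have h2 : ∀ y, HasFDerivAt W (innerSL ℝ (G y)) y := fun y => (hW y).hasFDerivAt
    have := second_derivative_symmetric h2 h1 v w
    simp only [ContinuousLinearMap.comp_apply, innerSL_apply_apply] at this
    rw [this, real_inner_comm]
  refine ⟨hsymm, fun η hη => ?_⟩
  have h1 : ∀ᶠ ξ in nhds (0 : E), ‖G (x + ξ) - G x - X ξ‖ ≤ η * ‖ξ‖ :=
    (hasFDerivAt_iff_isLittleO_nhds_zero.1 hX).bound hη
  obtain ⟨r, hr, hball⟩ := Metric.eventually_nhds_iff_ball.1 h1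
  filter_upwards [ball_mem_nhds (0 : E) hr] with ξ hξ
  have hderiv : ∀ ζ : E, HasFDerivAt (fun ζ => W (x + ζ) - ⟪G x, ζ⟫ - 2⁻¹ * ⟪X ζ, ζ⟫)
      (innerSL ℝ (G (x + ζ) - G x - X ζ)) ζ := by
    intro ζ
    have g1 : HasFDerivAt (fun ζ => W (x + ζ)) (innerSL ℝ (G (x + ζ))) ζ := by
      have := (hW (x + ζ)).hasFDerivAt.comp ζ ((hasFDerivAt_id ζ).const_add x)
      exact this
    have g2 : HasFDerivAt (fun ζ => ⟪G x, ζ⟫) (innerSL ℝ (G x)) ζ :=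
      (innerSL ℝ (G x)).hasFDerivAt
    have g3 := ((X.hasFDerivAt (x := ζ)).inner ℝ (hasFDerivAt_id ζ)).const_mul (2⁻¹ : ℝ)
    refine ((g1.sub g2).sub g3).congr_fderiv ?_
    ext v
    simp [fderivInnerCLM_apply]
    rw [hsymm v ζ, real_inner_comm (X ζ) v]
    ring
  have hmv := Convex.norm_image_sub_le_of_norm_hasFDerivWithin_le (𝕜 := ℝ) (C := η * ‖ξ‖)
    (s := closedBall (0 : E) ‖ξ‖) (x := 0) (y := ξ)
    (fun ζ _ => (hderiv ζ).hasFDerivWithinAt) (fun ζ hζ => ?_) (convex_closedBall _ _)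
    (mem_closedBall_self (norm_nonneg _)) (by simp)
  · simp only [add_zero, inner_zero_right, mul_zero, sub_zero, Real.norm_eq_abs] at hmv
    rw [show W (x + ξ) - W x - ⟪G x, ξ⟫ - 2⁻¹ * ⟪X ξ, ξ⟫ =
      W (x + ξ) - ⟪G x, ξ⟫ - 2⁻¹ * ⟪X ξ, ξ⟫ - W x by ring, pow_two, ← mul_assoc]
    exact hmv
  · rw [innerSL_apply_norm]
    have h2 : ‖ζ‖ ≤ ‖ξ‖ := by simpa using hζ
    have h3 : ‖ζ‖ < r := h2.trans_lt (by simpa using hξ)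
    exact (hball ζ (by simpa using h3)).trans (by gcongr)

open MeasureTheory in
/-- A Lipschitz map of a finite dimensional space into itself maps null sets to null sets. -/
lemma LipschitzOnWith.addHaar_image_eq_zero {V : Type*} [NormedAddCommGroup V] [NormedSpace ℝ V]
    [FiniteDimensional ℝ V] [MeasurableSpace V] [BorelSpace V] (μ : Measure V)
    [μ.IsAddHaarMeasure] {k : NNReal} {f : V → V} {s : Set V} (hf : LipschitzOnWith k f s)
    (hs : μ s = 0) : μ (f '' s) = 0 := by
  set ν : Measure V := Measure.hausdorffMeasure (Module.finrank ℝ V)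
  have : ν.IsAddHaarMeasure := isAddHaarMeasure_hausdorffMeasure
  have h1 : ν s = 0 := (Measure.absolutelyContinuous_isAddHaarMeasure ν μ) hs
  have h2 : ν (f '' s) = 0 := by
    refine le_antisymm ((hf.hausdorffMeasure_image_le (Nat.cast_nonneg _)).trans ?_) bot_le
    rw [h1, mul_zero]
  exact (Measure.absolutelyContinuous_isAddHaarMeasure μ ν) h2

lemma norm_normalize_sub_le {E : Type*} [NormedAddCommGroup E] [NormedSpace ℝ E] {s : ℝ}
    (hs : 0 < s) {z w : E} (hz : s ≤ ‖z‖) (hw : s ≤ ‖w‖) :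
    ‖‖z‖⁻¹ • z - ‖w‖⁻¹ • w‖ ≤ 2 / s * ‖z - w‖ := by
  have hz0 : 0 < ‖z‖ := hs.trans_le hz
  have hw0 : 0 < ‖w‖ := hs.trans_le hw
  have e : ‖z‖⁻¹ • z - ‖w‖⁻¹ • w = ‖z‖⁻¹ • (z - w) + (‖z‖⁻¹ * (‖w‖ - ‖z‖) * ‖w‖⁻¹) • w := by
    rw [smul_sub, sub_add, ← sub_smul]
    congr 2
    field_simp
    ring
  have h1 : ‖‖z‖⁻¹ • (z - w)‖ = ‖z‖⁻¹ * ‖z - w‖ := by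
    rw [norm_smul, norm_inv, norm_norm]
  have h2 : ‖(‖z‖⁻¹ * (‖w‖ - ‖z‖) * ‖w‖⁻¹) • w‖ = ‖z‖⁻¹ * |‖w‖ - ‖z‖| := by
    rw [norm_smul, norm_mul, norm_mul, norm_inv, norm_inv, norm_norm, norm_norm,
      Real.norm_eq_abs, mul_assoc, inv_mul_cancel₀ hw0.ne', mul_one]
  have h3 : |‖w‖ - ‖z‖| ≤ ‖z - w‖ := by
    rw [norm_sub_rev]; exact abs_norm_sub_norm_le _ _
  have h4 : ‖z‖⁻¹ ≤ s⁻¹ := inv_anti₀ hs hz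
  calc _ ≤ ‖z‖⁻¹ * ‖z - w‖ + ‖z‖⁻¹ * |‖w‖ - ‖z‖| := by
        rw [e, ← h1, ← h2]; exact norm_add_le _ _
    _ ≤ s⁻¹ * ‖z - w‖ + s⁻¹ * ‖z - w‖ := by gcongr
    _ = _ := by ring

lemma HasGradientAt.eq_of_eventually_le {E : Type*} [NormedAddCommGroup E] [InnerProductSpace ℝ E]
    [CompleteSpace E] {W : E → ℝ} {G g x : E} {C : ℝ} (hW : HasGradientAt W G x)
    (h : ∀ᶠ z in nhds x, W z ≤ W x + ⟪g, z - x⟫ + C * ‖z - x‖ ^ 2) : G = g := by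
  have hmax : IsLocalMax (fun z => W z - ⟪g, z - x⟫ - C * ‖z - x‖ ^ 2) x := by
    filter_upwards [h] with z hz
    simp only [sub_self, inner_zero_right, norm_zero]
    linarith
  have h1 : HasFDerivAt (fun z => z - x) (ContinuousLinearMap.id ℝ E) x :=
    (hasFDerivAt_id x).sub_const x
  have h2 : HasFDerivAt (fun z => ⟪g, z - x⟫) (innerSL ℝ g) x :=
    ((innerSL ℝ g).hasFDerivAt.comp x h1)
  have h3 := (hW.hasFDerivAt.sub h2).sub (h1.norm_sq.const_mul C)
  have h4 := hmax.hasFDerivAt_eq_zero h3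
  have h5 := congrArg (fun A : E →L[ℝ] ℝ => A (G - g)) h4
  simp at h5
  rw [← inner_sub_left, inner_self_eq_zero, sub_eq_zero] at h5
  exact h5

lemma norm_add_le_of_ne_zero {E : Type*} [NormedAddCommGroup E] [InnerProductSpace ℝ E]
    {z : E} (hz : 0 < ‖z‖) (ξ : E) :
    ‖z + ξ‖ ≤ ‖z‖ + ⟪‖z‖⁻¹ • z, ξ⟫ + (2 * ‖z‖)⁻¹ * ‖ξ‖ ^ 2 := by
  have h1 := norm_add_sq_real z ξ
  rw [real_inner_smul_left]
  have h2 : 0 ≤ (‖z + ξ‖ - ‖z‖) ^ 2 := sq_nonneg _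
  have h3 : ‖z‖ * ‖z + ξ‖ ≤ ‖z‖ * (‖z‖ + ‖z‖⁻¹ * ⟪z, ξ⟫ + (2 * ‖z‖)⁻¹ * ‖ξ‖ ^ 2) := by
    have : ‖z‖ * (‖z‖ + ‖z‖⁻¹ * ⟪z, ξ⟫ + (2 * ‖z‖)⁻¹ * ‖ξ‖ ^ 2) =
        ‖z‖ ^ 2 + ⟪z, ξ⟫ + ‖ξ‖ ^ 2 / 2 := by field_simp
    rw [this]
    nlinarith
  exact le_of_mul_le_mul_left h3 hz

lemma quadratic_le_of_taylor {E : Type*} [NormedAddCommGroup E] [InnerProductSpace ℝ E]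
    {W V : E → ℝ} {x y g h : E} {X Z : E →L[ℝ] E}
    (hW : ∀ η > 0, ∀ᶠ ξ in nhds (0 : E),
      |W (x + ξ) - W x - ⟪g, ξ⟫ - 2⁻¹ * ⟪X ξ, ξ⟫| ≤ η * ‖ξ‖ ^ 2)
    (hV : ∀ η > 0, ∀ᶠ ξ in nhds (0 : E),
      |V (y + ξ) - V y - ⟪h, ξ⟫ - 2⁻¹ * ⟪Z ξ, ξ⟫| ≤ η * ‖ξ‖ ^ 2)
    {ξ ζ : E} {α β : ℝ}
    (hle : ∀ᶠ t in nhds (0 : ℝ),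
      W (x + t • ξ) + V (y + t • ζ) ≤ W x + V y + α * t + β * t ^ 2) :
    ⟪X ξ, ξ⟫ + ⟪Z ζ, ζ⟫ ≤ 2 * β := by
  have key : ∀ η > 0, ⟪X ξ, ξ⟫ + ⟪Z ζ, ζ⟫ ≤ 2 * β + η * (2 * (‖ξ‖ ^ 2 + ‖ζ‖ ^ 2)) := by
    intro η hη
    have t1 : Filter.Tendsto (fun t : ℝ => t • ξ) (nhds 0) (nhds 0) :=
      Continuous.tendsto' (by fun_prop) _ _ (by simp)
    have t2 : Filter.Tendsto (fun t : ℝ => t • ζ) (nhds 0) (nhds 0) :=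
      Continuous.tendsto' (by fun_prop) _ _ (by simp)
    have t3 : Filter.Tendsto (fun t : ℝ => -t) (nhds 0) (nhds 0) :=
      Continuous.tendsto' (by fun_prop) _ _ (by simp)
    have hall := ((t1.eventually (hW η hη)).and (t2.eventually (hV η hη))).and hle
    have hall2 := hall.and (t3.eventually hall)
    obtain ⟨t, ⟨⟨⟨a1, a2⟩, a3⟩, ⟨b1, b2⟩, b3⟩, ht⟩ :=
      ((hall2.filter_mono nhdsWithin_le_nhds).and
        (self_mem_nhdsWithin : Ioi (0 : ℝ) ∈ nhdsWithin 0 (Ioi 0))).exists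
    simp only [inner_smul_right, map_smul, inner_smul_left, norm_smul, mul_pow, Real.norm_eq_abs,
      sq_abs, abs_le, conj_trivial] at a1 a2 a3 b1 b2 b3
    have ht' : 0 < t ^ 2 := pow_pos ht 2
    refine le_of_mul_le_mul_left ?_ ht'
    linarith [a1.1, a2.1, b1.1, b2.1]
  have hlim : Filter.Tendsto (fun η : ℝ => 2 * β + η * (2 * (‖ξ‖ ^ 2 + ‖ζ‖ ^ 2)))
      (nhdsWithin 0 (Ioi 0)) (nhds (2 * β)) :=
    (Continuous.tendsto' (by fun_prop) _ _ (by simp)).mono_left nhdsWithin_le_nhds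
  exact ge_of_tendsto hlim (Filter.eventually_of_mem self_mem_nhdsWithin key)

/-- The penalty `L (‖x - y‖ - κ ‖x - y‖²) + K/2 ‖x - x₀‖²` of the doubling of variables. -/
def doublingPenalty {E : Type*} [NormedAddCommGroup E] (L κ K : ℝ) (x₀ x y : E) : ℝ :=
  L * (‖x - y‖ - κ * ‖x - y‖ ^ 2) + K / 2 * ‖x - x₀‖ ^ 2

/-- The gradient of the first part of the penalty, as a function of `z = x - y`. -/
def doublingGrad {E : Type*} [NormedAddCommGroup E] [NormedSpace ℝ E] (L κ : ℝ) (z : E) : E :=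
  L • (‖z‖⁻¹ • z - (2 * κ) • z)

section penalty

variable {E : Type*} [NormedAddCommGroup E] [InnerProductSpace ℝ E] {L κ K : ℝ}

lemma doublingPenalty_left_le (hL : 0 ≤ L) (hκ : 0 ≤ κ) {x₀ x y : E} (hxy : 0 < ‖x - y‖) (z : E) :
    doublingPenalty L κ K x₀ z y ≤ doublingPenalty L κ K x₀ x y +
      ⟪doublingGrad L κ (x - y) + K • (x - x₀), z - x⟫ +
      (L * (2 * ‖x - y‖)⁻¹ + K / 2) * ‖z - x‖ ^ 2 := by
  have h1 := mul_le_mul_of_nonneg_left (norm_add_le_of_ne_zero hxy (z - x)) hL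
  have h2 := norm_add_sq_real (x - y) (z - x)
  have h3 := norm_add_sq_real (x - x₀) (z - x)
  rw [show x - y + (z - x) = z - y by abel] at h1 h2
  rw [show x - x₀ + (z - x) = z - x₀ by abel] at h3
  have h4 : 0 ≤ L * κ * ‖z - x‖ ^ 2 := by positivity
  simp only [doublingPenalty, doublingGrad, inner_add_left, inner_sub_left, real_inner_smul_left]
  simp only [inner_sub_left, real_inner_smul_left] at h1 h2 h3
  rw [h2, h3]
  linarith

lemma doublingPenalty_right_le (hL : 0 ≤ L) (hκ : 0 ≤ κ) {x₀ x y : E} (hxy : 0 < ‖x - y‖) (z : E) :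
    doublingPenalty L κ K x₀ x z ≤ doublingPenalty L κ K x₀ x y +
      ⟪-doublingGrad L κ (x - y), z - y⟫ + L * (2 * ‖x - y‖)⁻¹ * ‖z - y‖ ^ 2 := by
  have h1 := mul_le_mul_of_nonneg_left (norm_add_le_of_ne_zero hxy (-(z - y))) hL
  have h2 := norm_add_sq_real (x - y) (-(z - y))
  rw [show x - y + -(z - y) = x - z by abel] at h1 h2
  have h4 : 0 ≤ L * κ * ‖z - y‖ ^ 2 := by positivity
  simp only [doublingPenalty, doublingGrad, inner_neg_left, inner_sub_left, real_inner_smul_left]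
  simp only [inner_neg_right, norm_neg, inner_sub_left, real_inner_smul_left] at h1 h2
  rw [h2]
  linarith

lemma doublingPenalty_diagonal (x₀ x y ξ : E) (t : ℝ) :
    doublingPenalty L κ K x₀ (x + t • ξ) (y + t • ξ) = doublingPenalty L κ K x₀ x y +
      (K * ⟪x - x₀, ξ⟫) * t + K / 2 * ‖ξ‖ ^ 2 * t ^ 2 := by
  have h3 := norm_add_sq_real (x - x₀) (t • ξ)
  rw [inner_smul_right, norm_smul, mul_pow, Real.norm_eq_abs, sq_abs] at h3
  simp only [doublingPenalty]
  rw [show x + t • ξ - (y + t • ξ) = x - y by abel,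
    show x + t • ξ - x₀ = x - x₀ + t • ξ by abel, h3]
  ring

lemma doublingPenalty_antidiagonal {x₀ x y : E} (hxy : 0 < ‖x - y‖) {t : ℝ}
    (ht : 0 ≤ ‖x - y‖ + 2 * t) :
    doublingPenalty L κ K x₀ (x + t • (‖x - y‖⁻¹ • (x - y))) (y + t • -(‖x - y‖⁻¹ • (x - y))) =
      doublingPenalty L κ K x₀ x y +
      (2 * L - 4 * L * κ * ‖x - y‖ + K * ⟪x - x₀, ‖x - y‖⁻¹ • (x - y)⟫) * t +
      (K / 2 - 4 * L * κ) * t ^ 2 := by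
  set e := ‖x - y‖⁻¹ • (x - y) with he
  have hen : ‖e‖ = 1 := by
    rw [he, norm_smul, norm_inv, norm_norm, inv_mul_cancel₀ hxy.ne']
  have hxe : x - y = ‖x - y‖ • e := by
    rw [he, smul_smul, mul_inv_cancel₀ hxy.ne', one_smul]
  have h1 : ‖x + t • e - (y + t • -e)‖ = ‖x - y‖ + 2 * t := by
    have : x + t • e - (y + t • -e) = (‖x - y‖ + 2 * t) • e := by
      rw [add_smul, ← hxe]; module
    rw [this, norm_smul, hen, mul_one, Real.norm_of_nonneg ht]
  have h3 := norm_add_sq_real (x - x₀) (t • e)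
  rw [inner_smul_right, norm_smul, mul_pow, Real.norm_eq_abs, sq_abs, hen] at h3
  simp only [doublingPenalty]
  rw [h1, show x + t • e - x₀ = x - x₀ + t • e by abel, h3]
  ring

lemma norm_doublingGrad_le (hL : 0 ≤ L) (hκ : 0 < κ) {z : E} (hz : 0 < ‖z‖)
    (hz' : ‖z‖ ≤ (4 * κ)⁻¹) : ‖doublingGrad L κ z‖ ≤ L := by
  have h1 : ‖z‖⁻¹ • z - (2 * κ) • z = (1 - 2 * κ * ‖z‖) • (‖z‖⁻¹ • z) := by
    rw [smul_smul, ← sub_smul]; congr 1; field_simp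
  have h2 : κ * ‖z‖ ≤ 4⁻¹ := by
    calc κ * ‖z‖ ≤ κ * (4 * κ)⁻¹ := by gcongr
      _ = 4⁻¹ := by field_simp
  have h3 : 0 ≤ κ * ‖z‖ := by positivity
  rw [doublingGrad, h1, norm_smul, norm_smul, norm_smul, norm_inv, norm_norm,
    inv_mul_cancel₀ hz.ne', mul_one, Real.norm_of_nonneg hL, Real.norm_eq_abs,
    abs_of_nonneg (by linarith)]
  nlinarith

lemma norm_doublingGrad_sub_le (hL : 0 ≤ L) (hκ : 0 ≤ κ) {s : ℝ} (hs : 0 < s) {z w : E}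
    (hz : s ≤ ‖z‖) (hw : s ≤ ‖w‖) :
    ‖doublingGrad L κ z - doublingGrad L κ w‖ ≤ L * (2 / s + 2 * κ) * ‖z - w‖ := by
  have e : doublingGrad L κ z - doublingGrad L κ w =
      L • ((‖z‖⁻¹ • z - ‖w‖⁻¹ • w) - (2 * κ) • (z - w)) := by
    simp only [doublingGrad]; module
  rw [e, norm_smul, Real.norm_of_nonneg hL, mul_assoc]
  refine mul_le_mul_of_nonneg_left ((norm_sub_le _ _).trans ?_) hL
  rw [add_mul, norm_smul, Real.norm_of_nonneg (by positivity)]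
  gcongr
  exact norm_normalize_sub_le hs hz hw

end penalty

lemma exists_perturbed_max {E : Type*} [NormedAddCommGroup E] [InnerProductSpace ℝ E]
    [FiniteDimensional ℝ E] {u W V : E → ℝ} {x₀ : E} {R C L κ K θ s : ℝ} (hR : 0 < R)
    (hL : 0 ≤ L) (hκ : 0 < κ) (hK : 0 ≤ K) (hθ : 0 < θ)
    (hC : ∀ x ∈ closedBall x₀ R, |u x| ≤ C)
    (hs : ∀ x ∈ closedBall x₀ R, ∀ y ∈ closedBall x₀ R, ‖x - y‖ < s → |u x - u y| ≤ θ / 8)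
    (hWc : Continuous W) (hVc : Continuous V)
    (hW : ∀ x ∈ closedBall x₀ R, u x ≤ W x ∧ W x ≤ u x + θ / 8)
    (hV : ∀ x ∈ closedBall x₀ R, -u x ≤ V x ∧ V x ≤ -u x + θ / 8)
    (hκR : (4 * κ)⁻¹ ≤ R / 4) (hLC : 2 * C < L * (3 / 4 * (4 * κ)⁻¹))
    (hKC : 2 * C < K / 2 * (R / 2) ^ 2) {x₁ y₁ : E} (hx₁ : x₁ ∈ closedBall x₀ R)
    (hy₁ : y₁ ∈ closedBall x₀ R) (hxy₁ : ‖x₁ - y₁‖ ≤ (4 * κ)⁻¹)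
    (hpos : doublingPenalty L κ K x₀ x₁ y₁ + θ ≤ u x₁ - u y₁)
    {p q : E} (hp : ‖p‖ ≤ θ / (8 * R)) (hq : ‖q‖ ≤ θ / (8 * R)) :
    ∃ x y, ‖x - x₀‖ < R / 2 ∧ ‖y - x₀‖ < 3 * R / 4 ∧ s ≤ ‖x - y‖ ∧ ‖x - y‖ < (4 * κ)⁻¹ ∧
      ∀ᶠ z in nhds (x, y),
        W z.1 + V z.2 - doublingPenalty L κ K x₀ z.1 z.2 - ⟪p, z.1⟫ - ⟪q, z.2⟫ ≤
          W x + V y - doublingPenalty L κ K x₀ x y - ⟪p, x⟫ - ⟪q, y⟫ := by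
  have hcp : Continuous fun z : E × E =>
      W z.1 + V z.2 - doublingPenalty L κ K x₀ z.1 z.2 - ⟪p, z.1⟫ - ⟪q, z.2⟫ := by
    unfold doublingPenalty; fun_prop
  have hScomp : IsCompact ((closedBall x₀ R ×ˢ closedBall x₀ R) ∩
      {z : E × E | ‖z.1 - z.2‖ ≤ (4 * κ)⁻¹}) :=
    ((isCompact_closedBall x₀ R).prod (isCompact_closedBall x₀ R)).inter_right
      (isClosed_le (by fun_prop) continuous_const)
  obtain ⟨⟨x, y⟩, ⟨⟨hx, hy⟩, hxy⟩, hmax⟩ := hScomp.exists_isMaxOn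
    ⟨(x₁, y₁), ⟨hx₁, hy₁⟩, hxy₁⟩ hcp.continuousOn
  have h1 := hmax (⟨⟨hx₁, hy₁⟩, hxy₁⟩ : (x₁, y₁) ∈ (closedBall x₀ R ×ˢ closedBall x₀ R) ∩
      {z : E × E | ‖z.1 - z.2‖ ≤ (4 * κ)⁻¹})
  simp only [mem_ofPred_eq] at h1 hxy hx hy
  have hlin : ∀ v : E, ‖v‖ ≤ θ / (8 * R) → ∀ z ∈ closedBall x₀ R, |⟪v, z - x₀⟫| ≤ θ / 8 := by
    intro v hv z hz
    rw [mem_closedBall, dist_eq_norm] at hz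
    calc |⟪v, z - x₀⟫| ≤ ‖v‖ * ‖z - x₀‖ := abs_real_inner_le_norm _ _
      _ ≤ θ / (8 * R) * R := by gcongr
      _ = θ / 8 := by field_simp
  have a1 := abs_le.1 (hlin p hp _ hx₁)
  have a2 := abs_le.1 (hlin q hq _ hy₁)
  have a3 := abs_le.1 (hlin p hp _ hx)
  have a4 := abs_le.1 (hlin q hq _ hy)
  rw [inner_sub_right] at a1 a2 a3 a4
  have h2 : doublingPenalty L κ K x₀ x y + θ / 4 ≤ u x - u y := by
    linarith [(hW x₁ hx₁).1, (hV y₁ hy₁).1, (hW x hx).2, (hV y hy).2]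
  have hκxy : κ * ‖x - y‖ ≤ 1 / 4 := by
    calc κ * ‖x - y‖ ≤ κ * (4 * κ)⁻¹ := by gcongr
      _ = 1 / 4 := by field_simp
  have hψ : 3 / 4 * ‖x - y‖ ≤ ‖x - y‖ - κ * ‖x - y‖ ^ 2 := by
    nlinarith [norm_nonneg (x - y)]
  have hΦ1 := mul_le_mul_of_nonneg_left hψ hL
  have hΦ2 : 0 ≤ K / 2 * ‖x - x₀‖ ^ 2 := by positivity
  have hΦ3 : 0 ≤ L * (3 / 4 * ‖x - y‖) := by positivity
  have hux := abs_le.1 (hC x hx)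
  have huy := abs_le.1 (hC y hy)
  have b1 : ‖x - x₀‖ < R / 2 := by
    by_contra hcon
    push Not at hcon
    have : K / 2 * (R / 2) ^ 2 ≤ K / 2 * ‖x - x₀‖ ^ 2 := by gcongr
    unfold doublingPenalty at h2
    linarith [hux.2, huy.1]
  have b2 : ‖x - y‖ < (4 * κ)⁻¹ := by
    by_contra hcon
    push Not at hcon
    have : L * (3 / 4 * (4 * κ)⁻¹) ≤ L * (3 / 4 * ‖x - y‖) := by gcongr
    unfold doublingPenalty at h2
    linarith [hux.2, huy.1]
  have b3 : s ≤ ‖x - y‖ := by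
    by_contra hcon
    push Not at hcon
    have := (abs_le.1 (hs x hx y hy hcon)).2
    unfold doublingPenalty at h2
    linarith
  have b4 : ‖y - x₀‖ < 3 * R / 4 := by
    have := norm_sub_le (x - x₀) (x - y)
    rw [show x - x₀ - (x - y) = y - x₀ by abel] at this
    linarith
  refine ⟨x, y, b1, b4, b3, b2, ?_⟩
  have c1 : ∀ᶠ z : E × E in nhds (x, y), ‖z.1 - x₀‖ < R :=
    (Continuous.continuousAt (by fun_prop)).eventually_lt_const (by simp only; linarith)
  have c2 : ∀ᶠ z : E × E in nhds (x, y), ‖z.2 - x₀‖ < R :=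
    (Continuous.continuousAt (by fun_prop)).eventually_lt_const (by simp only; linarith)
  have c3 : ∀ᶠ z : E × E in nhds (x, y), ‖z.1 - z.2‖ < (4 * κ)⁻¹ :=
    (Continuous.continuousAt (by fun_prop)).eventually_lt_const b2
  filter_upwards [c1, c2, c3] with z d1 d2 d3
  exact hmax ⟨⟨by rw [mem_closedBall, dist_eq_norm]; exact d1.le,
    by rw [mem_closedBall, dist_eq_norm]; exact d2.le⟩, d3.le⟩

open MeasureTheory in
/-- If every small `w` is the image under a Lipschitz map of a point where `Q w` holds, then `w` can
be chosen such that this point avoids a given null set. -/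
lemma exists_notMem_null_of_lipschitzOn {V : Type*} [NormedAddCommGroup V] [NormedSpace ℝ V]
    [FiniteDimensional ℝ V] [MeasurableSpace V] [BorelSpace V] (μ : Measure V)
    [μ.IsAddHaarMeasure] {k : NNReal} {f : V → V} {T Z : Set V} (hf : LipschitzOnWith k f T)
    (hZ : μ Z = 0) {η : ℝ} (hη : 0 < η) {Q : V → V → Prop}
    (hQ : ∀ w z, Q w z → z ∈ T ∧ f z = w) (hex : ∀ w, ‖w‖ < η → ∃ z, Q w z) :
    ∃ w z, ‖w‖ < η ∧ Q w z ∧ z ∉ Z := by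
  have h0 : μ (f '' (T ∩ Z)) = 0 :=
    (hf.mono inter_subset_left).addHaar_image_eq_zero μ (measure_mono_null inter_subset_right hZ)
  have hpos : 0 < μ (ball (0 : V) η) := measure_ball_pos μ 0 hη
  obtain ⟨w, hw, hw'⟩ : ∃ w ∈ ball (0 : V) η, w ∉ f '' (T ∩ Z) := by
    by_contra hcon
    push Not at hcon
    exact hpos.ne' (measure_mono_null hcon h0)
  have hwη : ‖w‖ < η := by simpa using hw
  obtain ⟨z, hz⟩ := hex w hwη
  exact ⟨w, z, hwη, hz, fun hzZ => hw' ⟨z, ⟨(hQ w z hz).1, hzZ⟩, (hQ w z hz).2⟩⟩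

/-- `(p, X)` is a second order superjet of `u` at `x`, up to an arbitrarily small quadratic
error. -/
def IsSuperjet {E : Type*} [NormedAddCommGroup E] [InnerProductSpace ℝ E] (u : E → ℝ) (x p : E)
    (X : E →L[ℝ] E) : Prop :=
  (∀ v w, ⟪X v, w⟫ = ⟪v, X w⟫) ∧ ∀ η > 0, ∀ᶠ ξ in nhds (0 : E),
    u (x + ξ) ≤ u x + ⟪p, ξ⟫ + 2⁻¹ * ⟪X ξ, ξ⟫ + η * ‖ξ‖ ^ 2

lemma exists_regularization_near {E : Type*} [NormedAddCommGroup E] [InnerProductSpace ℝ E]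
    [FiniteDimensional ℝ E] {u : E → ℝ} {x₀ : E} {R C τ s a : ℝ} (hR : 0 < R) (hs0 : 0 < s)
    (hu : ContinuousOn u (closedBall x₀ R)) (hC : ∀ x ∈ closedBall x₀ R, |u x| ≤ C)
    (hs : ∀ x ∈ closedBall x₀ R, ∀ y ∈ closedBall x₀ R, ‖x - y‖ < s → |u x - u y| ≤ τ)
    (ha : 0 < a) (haC : 2 * C < a * s ^ 2) :
    ∃ (W : E → ℝ) (G : E → E) (k : NNReal), LipschitzWith k G ∧
      (∀ x, HasGradientAt W (G x) x) ∧
      (∀ x ∈ closedBall x₀ R, u x ≤ W x ∧ W x ≤ u x + τ) ∧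
      ∀ x B X, B < 2 * a →
        (∀ᶠ z in nhds x, W z ≤ W x + ⟪G x, z - x⟫ + B * ‖z - x‖ ^ 2) →
        ‖x - x₀‖ + (4 * a)⁻¹ * ‖G x‖ < R → HasFDerivAt G X x →
        IsSuperjet u (x + (4 * a)⁻¹ • G x) (G x) X := by
  obtain ⟨W, G, k, hG, hW, huW, hWu, htr⟩ := exists_lasry_lions_regularization
    (isCompact_closedBall x₀ R) ⟨x₀, mem_closedBall_self hR.le⟩ hu ha
  refine ⟨W, G, k, hG, hW, fun x hx => ⟨huW x hx, ?_⟩, ?_⟩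
  · obtain ⟨x', hx', hle⟩ := hWu x
    have h1 := huW x hx
    have h2 := abs_le.1 (hC x hx)
    have h3 := abs_le.1 (hC x' hx')
    have h4 : ‖x - x'‖ < s := by
      by_contra hcon
      push Not at hcon
      have : a * s ^ 2 ≤ a * ‖x - x'‖ ^ 2 := by gcongr
      linarith [h2.1, h3.2]
    have h5 := (abs_le.1 (hs x hx x' hx' h4)).1
    have h6 : 0 ≤ a * ‖x - x'‖ ^ 2 := by positivity
    linarith
  · intro x B X hB hcontact hmargin hX
    obtain ⟨hsymm, htaylor⟩ := taylor_two_of_hasGradientAt hW hX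
    obtain ⟨-, hle⟩ := htr x B hB hcontact
    refine ⟨hsymm, fun η hη => ?_⟩
    have hin : ∀ᶠ ξ in nhds (0 : E), ‖x + (4 * a)⁻¹ • G x + ξ - x₀‖ < R := by
      have hcont : ContinuousAt (fun ξ : E => ‖x + (4 * a)⁻¹ • G x + ξ - x₀‖) 0 := by fun_prop
      refine hcont.eventually_lt_const ?_
      have := norm_add_le (x - x₀) ((4 * a)⁻¹ • G x)
      rw [norm_smul, Real.norm_of_nonneg (by positivity)] at this
      simp only [add_zero, add_sub_right_comm]
      linarith
    filter_upwards [hin, htaylor η hη] with ξ h1 h2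
    have h3 := hle ξ (by rw [mem_closedBall, dist_eq_norm]; exact h1.le)
    have h4 := (abs_le.1 h2).2
    linarith

open MeasureTheory in
/-- The conclusion of the theorem on sums for the penalty of the Ishii–Lions method. -/
lemma exists_superjets_of_doubling {E : Type*} [NormedAddCommGroup E] [InnerProductSpace ℝ E]
    [FiniteDimensional ℝ E] {u : E → ℝ} {x₀ : E} {R C L κ K : ℝ}
    (hR : 0 < R) (hL : 0 ≤ L) (hκ : 0 < κ) (hK : 0 ≤ K)
    (hu : ContinuousOn u (closedBall x₀ R))
    (hC : ∀ x ∈ closedBall x₀ R, |u x| ≤ C)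
    (hκR : (4 * κ)⁻¹ ≤ R / 4) (hLC : 2 * C < L * (3 / 4 * (4 * κ)⁻¹))
    (hKC : 2 * C < K / 2 * (R / 2) ^ 2) {x₁ y₁ : E} (hx₁ : x₁ ∈ closedBall x₀ R)
    (hy₁ : y₁ ∈ closedBall x₀ R) (hxy₁ : ‖x₁ - y₁‖ ≤ (4 * κ)⁻¹)
    (hpos : doublingPenalty L κ K x₀ x₁ y₁ < u x₁ - u y₁) :
    ∃ (x y p q e : E) (X Z : E →L[ℝ] E), x ∈ closedBall x₀ R ∧ y ∈ closedBall x₀ R ∧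
      IsSuperjet u x p X ∧ IsSuperjet (fun z => -u z) y q Z ∧
      ‖p‖ ≤ L + K * R + 1 ∧ ‖q‖ ≤ L + 1 ∧ ‖e‖ = 1 ∧
      (∀ ξ, ⟪X ξ, ξ⟫ + ⟪Z ξ, ξ⟫ ≤ K * ‖ξ‖ ^ 2) ∧
      ⟪X e, e⟫ + ⟪Z e, e⟫ ≤ K - 8 * (L * κ) := by
  obtain ⟨θ, hθ, hθle⟩ : ∃ θ > 0, doublingPenalty L κ K x₀ x₁ y₁ + θ ≤ u x₁ - u y₁ :=
    ⟨_, sub_pos.2 hpos, (add_sub_cancel _ _).le⟩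
  obtain ⟨s, hs0, hs⟩ : ∃ s > 0, ∀ x ∈ closedBall x₀ R, ∀ y ∈ closedBall x₀ R,
      ‖x - y‖ < s → |u x - u y| ≤ θ / 8 := by
    have huc := (isCompact_closedBall x₀ R).uniformContinuousOn_of_continuous hu
    obtain ⟨s, hs, h⟩ := Metric.uniformContinuousOn_iff.1 huc (θ / 8) (by positivity)
    refine ⟨s, hs, fun x hx y hy hxy => ?_⟩
    have := h x hx y hy (by rwa [dist_eq_norm])
    rw [Real.dist_eq] at this
    exact this.le
  have hC0 : 0 ≤ C := (abs_nonneg _).trans (hC x₀ (mem_closedBall_self hR.le))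
  obtain ⟨a, ha0, ha1, ha2, ha3⟩ : ∃ a : ℝ, 0 < a ∧ 2 * C < a * s ^ 2 ∧
      L * (2 * s)⁻¹ + K / 2 < 2 * a ∧ (4 * a)⁻¹ * (L + K * R + 1) < R / 4 := by
    refine ⟨2 * C / s ^ 2 + (L * (2 * s)⁻¹ + K / 2) + (L + K * R + 1) / R + 1,
      by positivity, ?_, ?_, ?_⟩
    · have h1 : 2 * C = 2 * C / s ^ 2 * s ^ 2 := by field_simp
      have h2 : 0 < (L * (2 * s)⁻¹ + K / 2 + (L + K * R + 1) / R + 1) * s ^ 2 := by positivity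
      calc 2 * C = 2 * C / s ^ 2 * s ^ 2 := h1
        _ < 2 * C / s ^ 2 * s ^ 2 +
          (L * (2 * s)⁻¹ + K / 2 + (L + K * R + 1) / R + 1) * s ^ 2 := by linarith
        _ = _ := by ring
    · have h1 : 0 ≤ 2 * C / s ^ 2 := by positivity
      have h2 : 0 ≤ (L + K * R + 1) / R := by positivity
      have h3 : 0 ≤ L * (2 * s)⁻¹ + K / 2 := by positivity
      linarith
    · have h1 : 0 ≤ 2 * C / s ^ 2 := by positivity
      have h3 : 0 ≤ L * (2 * s)⁻¹ + K / 2 := by positivity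
      rw [inv_mul_lt_iff₀ (by positivity)]
      have h4 : (L + K * R + 1) / R * R = L + K * R + 1 := by field_simp
      nlinarith [mul_nonneg h1 hR.le, mul_nonneg h3 hR.le]
  obtain ⟨W, G, k₁, hGlip, hWG, hWu, hWtr⟩ :=
    exists_regularization_near hR hs0 hu hC hs ha0 ha1
  obtain ⟨V, H, k₂, hHlip, hVH, hVu, hVtr⟩ :=
    exists_regularization_near (u := fun z => -u z) hR hs0 hu.neg
      (fun x hx => by rw [abs_neg]; exact hC x hx)
      (fun x hx y hy hxy => by
        rw [← neg_sub', abs_neg]; exact hs x hx y hy hxy) ha0 ha1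
  have hWc : Continuous W := continuous_iff_continuousAt.2 fun x => (hWG x).continuousAt
  have hVc : Continuous V := continuous_iff_continuousAt.2 fun x => (hVH x).continuousAt
  set η : ℝ := min (θ / (8 * R)) 1 with hη
  have hη0 : 0 < η := lt_min (by positivity) one_pos
  -- the perturbed contact relation
  set Q : E × E → E × E → Prop := fun w z =>
    ‖z.1 - x₀‖ < R / 2 ∧ ‖z.2 - x₀‖ < 3 * R / 4 ∧ s ≤ ‖z.1 - z.2‖ ∧ ‖z.1 - z.2‖ < (4 * κ)⁻¹ ∧
      ∀ᶠ z' in nhds z,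
        W z'.1 + V z'.2 - doublingPenalty L κ K x₀ z'.1 z'.2 - ⟪w.1, z'.1⟫ - ⟪w.2, z'.2⟫ ≤
          W z.1 + V z.2 - doublingPenalty L κ K x₀ z.1 z.2 - ⟪w.1, z.1⟫ - ⟪w.2, z.2⟫ with hQ
  have hQex : ∀ w : E × E, ‖w‖ < η → ∃ z, Q w z := by
    intro w hw
    have h1 : ‖w‖ ≤ θ / (8 * R) := hw.le.trans (min_le_left _ _)
    obtain ⟨x, y, h⟩ := exists_perturbed_max hR hL hκ hK hθ hC hs hWc hVc hWu hVu hκR hLC hKC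
      hx₁ hy₁ hxy₁ hθle ((norm_fst_le w).trans h1) ((norm_snd_le w).trans h1)
    exact ⟨(x, y), h⟩
  have hcontact : ∀ w z, Q w z →
      (∀ᶠ x in nhds z.1, W x ≤ W z.1 +
        ⟪doublingGrad L κ (z.1 - z.2) + K • (z.1 - x₀) + w.1, x - z.1⟫ +
        (L * (2 * s)⁻¹ + K / 2) * ‖x - z.1‖ ^ 2) ∧
      (∀ᶠ y in nhds z.2, V y ≤ V z.2 + ⟪-doublingGrad L κ (z.1 - z.2) + w.2, y - z.2⟫ +
        (L * (2 * s)⁻¹ + K / 2) * ‖y - z.2‖ ^ 2) := by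
    rintro w ⟨x, y⟩ ⟨-, -, hsz, -, hev⟩
    have hpos : 0 < ‖x - y‖ := hs0.trans_le hsz
    have hinv : L * (2 * ‖x - y‖)⁻¹ ≤ L * (2 * s)⁻¹ := by gcongr
    constructor
    · have ht : Filter.Tendsto (fun x' => (x', y)) (nhds x) (nhds (x, y)) :=
        Continuous.tendsto (by fun_prop) x
      filter_upwards [ht.eventually hev] with x' hx'
      have h1 := doublingPenalty_left_le (K := K) (x₀ := x₀) hL hκ.le hpos x'
      have h2 := mul_le_mul_of_nonneg_right hinv (sq_nonneg ‖x' - x‖)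
      rw [inner_add_left, inner_sub_right w.1]
      linarith
    · have ht : Filter.Tendsto (fun y' => (x, y')) (nhds y) (nhds (x, y)) :=
        Continuous.tendsto (by fun_prop) y
      filter_upwards [ht.eventually hev] with y' hy'
      have h1 := doublingPenalty_right_le (K := K) (x₀ := x₀) hL hκ.le hpos y'
      have h2 := mul_le_mul_of_nonneg_right hinv (sq_nonneg ‖y' - y‖)
      have h3 : 0 ≤ K / 2 * ‖y' - y‖ ^ 2 := by positivity
      rw [inner_add_left, inner_sub_right w.2]
      linarith
  have hgrad : ∀ w z, Q w z →
      G z.1 = doublingGrad L κ (z.1 - z.2) + K • (z.1 - x₀) + w.1 ∧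
      H z.2 = -doublingGrad L κ (z.1 - z.2) + w.2 := fun w z hwz =>
    ⟨(hWG z.1).eq_of_eventually_le (hcontact w z hwz).1,
      (hVH z.2).eq_of_eventually_le (hcontact w z hwz).2⟩
  -- the map recovering the perturbation from the contact point
  set Ψ : E × E → E × E := fun z =>
    (G z.1 - doublingGrad L κ (z.1 - z.2) - K • (z.1 - x₀),
      H z.2 + doublingGrad L κ (z.1 - z.2)) with hΨ
  have hΨlip : LipschitzOnWith (k₁ + k₂ + 2 * (L * (2 / s + 2 * κ)) + K).toNNReal Ψ
      {z | s ≤ ‖z.1 - z.2‖} := by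
    refine LipschitzOnWith.of_dist_le_mul fun z hz w hw => ?_
    have h1 := norm_doublingGrad_sub_le (κ := κ) hL hκ.le hs0 hz hw
    have h2 : ‖z.1 - z.2 - (w.1 - w.2)‖ ≤ 2 * ‖z - w‖ := by
      have := norm_sub_le (z.1 - w.1) (z.2 - w.2)
      rw [show z.1 - w.1 - (z.2 - w.2) = z.1 - z.2 - (w.1 - w.2) by abel] at this
      have e1 : ‖z.1 - w.1‖ ≤ ‖z - w‖ := norm_fst_le (z - w)
      have e2 : ‖z.2 - w.2‖ ≤ ‖z - w‖ := norm_snd_le (z - w)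
      linarith
    have h3 : ‖doublingGrad L κ (z.1 - z.2) - doublingGrad L κ (w.1 - w.2)‖ ≤
        2 * (L * (2 / s + 2 * κ)) * ‖z - w‖ := by
      refine h1.trans ?_
      calc _ ≤ L * (2 / s + 2 * κ) * (2 * ‖z - w‖) := by gcongr
        _ = _ := by ring
    have h4 : ‖G z.1 - G w.1‖ ≤ k₁ * ‖z - w‖ :=
      (hGlip.norm_sub_le _ _).trans (by gcongr; exact norm_fst_le (z - w))
    have h5 : ‖H z.2 - H w.2‖ ≤ k₂ * ‖z - w‖ :=
      (hHlip.norm_sub_le _ _).trans (by gcongr; exact norm_snd_le (z - w))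
    have h6 : ‖K • (z.1 - w.1)‖ ≤ K * ‖z - w‖ := by
      rw [norm_smul, Real.norm_of_nonneg hK]; gcongr; exact norm_fst_le (z - w)
    have hk₁ : 0 ≤ k₁ * ‖z - w‖ := by positivity
    have hk₂ : 0 ≤ k₂ * ‖z - w‖ := by positivity
    have hKn : 0 ≤ K * ‖z - w‖ := by positivity
    rw [dist_eq_norm, dist_eq_norm, Real.coe_toNNReal _ (by positivity), add_mul, add_mul, add_mul]
    refine max_le ?_ ?_
    · have e : (Ψ z - Ψ w).1 = (G z.1 - G w.1) -
          (doublingGrad L κ (z.1 - z.2) - doublingGrad L κ (w.1 - w.2)) - K • (z.1 - w.1) := by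
        simp only [hΨ, Prod.fst_sub]; module
      rw [e]
      have := norm_sub_le (G z.1 - G w.1 -
        (doublingGrad L κ (z.1 - z.2) - doublingGrad L κ (w.1 - w.2))) (K • (z.1 - w.1))
      have := norm_sub_le (G z.1 - G w.1)
        (doublingGrad L κ (z.1 - z.2) - doublingGrad L κ (w.1 - w.2))
      linarith
    · have e : (Ψ z - Ψ w).2 = (H z.2 - H w.2) +
          (doublingGrad L κ (z.1 - z.2) - doublingGrad L κ (w.1 - w.2)) := by
        simp only [hΨ, Prod.snd_sub]; module
      rw [e]
      have := norm_add_le (H z.2 - H w.2)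
        (doublingGrad L κ (z.1 - z.2) - doublingGrad L κ (w.1 - w.2))
      linarith
  let _ : MeasurableSpace E := borel E
  have _ : BorelSpace E := ⟨rfl⟩
  let μ : Measure E := Measure.addHaar
  have hnull : ∀ᵐ z ∂(μ.prod μ), DifferentiableAt ℝ G z.1 ∧ DifferentiableAt ℝ H z.2 :=
    (Measure.quasiMeasurePreserving_fst.ae hGlip.ae_differentiableAt).and
      (Measure.quasiMeasurePreserving_snd.ae hHlip.ae_differentiableAt)
  obtain ⟨w, z, hwη, hwz, hz⟩ := exists_notMem_null_of_lipschitzOn (μ.prod μ) hΨlip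
    (ae_iff.1 hnull) hη0 (Q := Q) (fun w z hwz => ⟨hwz.2.2.1, by
      obtain ⟨h1, h2⟩ := hgrad w z hwz
      simp only [hΨ]
      rw [h1, h2]
      exact Prod.ext (by simp only; abel) (by simp only; abel)⟩) hQex
  obtain ⟨hGd, hHd⟩ : DifferentiableAt ℝ G z.1 ∧ DifferentiableAt ℝ H z.2 := not_not.1 hz
  obtain ⟨hc1, hc2⟩ := hcontact w z hwz
  obtain ⟨hg1, hg2⟩ := hgrad w z hwz
  rw [← hg1] at hc1
  rw [← hg2] at hc2
  obtain ⟨x, y⟩ := z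
  obtain ⟨hx, hy, hsz, hzκ, hev⟩ := hwz
  simp only at hGd hHd hc1 hc2 hg1 hg2 hx hy hsz hzκ hev
  have hxy : 0 < ‖x - y‖ := hs0.trans_le hsz
  have hw1 : ‖w.1‖ ≤ 1 := (norm_fst_le w).trans (hwη.le.trans (min_le_right _ _))
  have hw2 : ‖w.2‖ ≤ 1 := (norm_snd_le w).trans (hwη.le.trans (min_le_right _ _))
  have hdg := norm_doublingGrad_le hL hκ hxy hzκ.le
  have hGn : ‖G x‖ ≤ L + K * R + 1 := by
    have h1 : ‖K • (x - x₀)‖ ≤ K * R := by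
      rw [norm_smul, Real.norm_of_nonneg hK]; gcongr; linarith
    rw [hg1]
    exact (norm_add₃_le).trans (by linarith)
  have hHn : ‖H y‖ ≤ L + 1 := by
    rw [hg2]
    refine (norm_add_le _ _).trans ?_
    rw [norm_neg]; linarith
  have hHn' : ‖H y‖ ≤ L + K * R + 1 := by
    have : 0 ≤ K * R := by positivity
    linarith
  have hm1 : (4 * a)⁻¹ * ‖G x‖ < R / 4 := (by gcongr : _ ≤ _).trans_lt ha3
  have hm2 : (4 * a)⁻¹ * ‖H y‖ < R / 4 := (by gcongr : _ ≤ _).trans_lt ha3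
  have hmem : ∀ v g : E, ‖v - x₀‖ + (4 * a)⁻¹ * ‖g‖ < R → v + (4 * a)⁻¹ • g ∈ closedBall x₀ R := by
    intro v g h
    have := norm_add_le (v - x₀) ((4 * a)⁻¹ • g)
    rw [norm_smul, Real.norm_of_nonneg (by positivity)] at this
    rw [mem_closedBall, dist_eq_norm, add_sub_right_comm]
    linarith
  have hmarg1 : ‖x - x₀‖ + (4 * a)⁻¹ * ‖G x‖ < R := by linarith
  have hmarg2 : ‖y - x₀‖ + (4 * a)⁻¹ * ‖H y‖ < R := by linarith
  obtain ⟨-, hT1⟩ := taylor_two_of_hasGradientAt hWG hGd.hasFDerivAt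
  obtain ⟨-, hT2⟩ := taylor_two_of_hasGradientAt hVH hHd.hasFDerivAt
  have hpath : ∀ ξ ζ : E, Filter.Tendsto (fun t : ℝ => (x + t • ξ, y + t • ζ)) (nhds 0)
      (nhds (x, y)) := fun ξ ζ => Continuous.tendsto' (by fun_prop) _ _ (by simp)
  refine ⟨_, _, G x, H y, ‖x - y‖⁻¹ • (x - y), fderiv ℝ G x, fderiv ℝ H y, hmem _ _ hmarg1,
    hmem _ _ hmarg2, hWtr x _ _ ha2 hc1 hmarg1 hGd.hasFDerivAt,
    hVtr y _ _ ha2 hc2 hmarg2 hHd.hasFDerivAt, hGn, hHn, ?_, fun ξ => ?_, ?_⟩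
  · rw [norm_smul, norm_inv, norm_norm, inv_mul_cancel₀ hxy.ne']
  · have := quadratic_le_of_taylor hT1 hT2 (ξ := ξ) (ζ := ξ)
      (α := K * ⟪x - x₀, ξ⟫ + ⟪w.1, ξ⟫ + ⟪w.2, ξ⟫) (β := K / 2 * ‖ξ‖ ^ 2) ?_
    · linarith
    · filter_upwards [(hpath ξ ξ).eventually hev] with t ht
      simp only [doublingPenalty_diagonal, inner_add_right, inner_smul_right] at ht
      linarith
  · have := quadratic_le_of_taylor hT1 hT2 (ξ := ‖x - y‖⁻¹ • (x - y))
      (ζ := -(‖x - y‖⁻¹ • (x - y)))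
      (α := (2 * L - 4 * L * κ * ‖x - y‖ + K * ⟪x - x₀, ‖x - y‖⁻¹ • (x - y)⟫) +
        ⟪w.1, ‖x - y‖⁻¹ • (x - y)⟫ - ⟪w.2, ‖x - y‖⁻¹ • (x - y)⟫) (β := K / 2 - 4 * L * κ) ?_
    · rw [map_neg, inner_neg_neg] at this
      linarith
    · have hnn : ∀ᶠ t in nhds (0 : ℝ), 0 < ‖x - y‖ + 2 * t :=
        (Continuous.continuousAt (by fun_prop)).eventually_const_lt (by simpa using hxy)
      filter_upwards [hnn, (hpath _ (-(‖x - y‖⁻¹ • (x - y)))).eventually hev] with t ht0 ht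
      rw [doublingPenalty_antidiagonal hxy ht0.le] at ht
      rw [inner_add_right, inner_add_right, inner_smul_right w.1 _ t, inner_smul_right w.2 _ t,
        inner_neg_right] at ht
      linarith

/-- The matrix of an operator in the standard basis. -/
def opMatrix {N : ℕ} (T : Euc N →L[ℝ] Euc N) : Matrix (Fin N) (Fin N) ℝ :=
  Matrix.of fun i j => ⟪T (EuclideanSpace.single i (1 : ℝ)), EuclideanSpace.single j (1 : ℝ)⟫

lemma opMatrix_add {N : ℕ} (S T : Euc N →L[ℝ] Euc N) :
    opMatrix (S + T) = opMatrix S + opMatrix T := by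
  ext i j
  simp [opMatrix, inner_add_left]

lemma opMatrix_neg {N : ℕ} (T : Euc N →L[ℝ] Euc N) : opMatrix (-T) = -opMatrix T := by
  ext i j
  simp [opMatrix]

lemma opMatrix_smul_id {N : ℕ} (c : ℝ) :
    opMatrix (c • ContinuousLinearMap.id ℝ (Euc N)) = c • (1 : Matrix (Fin N) (Fin N) ℝ) := by
  ext i j
  simp only [opMatrix, Matrix.of_apply, smul_apply, ContinuousLinearMap.id_apply, inner_smul_left,
    EuclideanSpace.inner_single_left, Matrix.smul_apply, Matrix.one_apply, RCLike.conj_to_real,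
    PiLp.single_apply, smul_eq_mul]
  simp

lemma opMatrix_isSymm {N : ℕ} {T : Euc N →L[ℝ] Euc N} (hT : ∀ v w, ⟪T v, w⟫ = ⟪v, T w⟫) :
    (opMatrix T).IsSymm := by
  ext i j
  simp only [opMatrix, Matrix.transpose_apply, Matrix.of_apply]
  rw [hT, real_inner_comm]

lemma inner_eq_sum_opMatrix {N : ℕ} (T : Euc N →L[ℝ] Euc N) (v : Euc N) :
    ⟪T v, v⟫ = ∑ i, ∑ j, v i * v j * opMatrix T i j := by
  have hv : v = ∑ i, v i • EuclideanSpace.single i (1 : ℝ) := by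
    ext j
    simp [Finset.sum_apply, Pi.single_apply]
  conv_lhs => rw [hv]
  simp only [map_sum, map_smul, sum_inner, inner_sum, inner_smul_left, inner_smul_right, opMatrix,
    Matrix.of_apply, RCLike.conj_to_real, Finset.mul_sum]
  rw [Finset.sum_comm]
  refine Finset.sum_congr rfl fun i _ => Finset.sum_congr rfl fun j _ => ?_
  ring

lemma opMatrix_posSemidef {N : ℕ} {T : Euc N →L[ℝ] Euc N} (hT : ∀ v w, ⟪T v, w⟫ = ⟪v, T w⟫)
    (hpos : ∀ v, 0 ≤ ⟪T v, v⟫) : (opMatrix T).PosSemidef := by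
  refine Matrix.PosSemidef.of_dotProduct_mulVec_nonneg ?_ fun v => ?_
  · rw [Matrix.IsHermitian, Matrix.conjTranspose_eq_transpose_of_trivial]
    exact opMatrix_isSymm hT
  · have := hpos (WithLp.toLp 2 v)
    rw [inner_eq_sum_opMatrix] at this
    refine this.trans_eq ?_
    simp only [dotProduct, Matrix.mulVec, Finset.mul_sum, star_trivial]
    refine Finset.sum_congr rfl fun i _ => Finset.sum_congr rfl fun j _ => ?_
    ring

lemma inner_le_trace_opMatrix {N : ℕ} {T : Euc N →L[ℝ] Euc N}
    (hT : ∀ v w, ⟪T v, w⟫ = ⟪v, T w⟫) (hpos : ∀ v, 0 ≤ ⟪T v, v⟫) {e : Euc N} (he : ‖e‖ = 1) :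
    ⟪T e, e⟫ ≤ (opMatrix T).trace := by
  have he2 : ∑ i, e i ^ 2 = 1 := by
    rw [← EuclideanSpace.real_norm_sq_eq, he, one_pow]
  have hsymm := opMatrix_isSymm hT
  have key : ∀ i j, 2 * (e i * e j * opMatrix T i j) ≤
      e j ^ 2 * opMatrix T i i + e i ^ 2 * opMatrix T j j := by
    intro i j
    have h1 := hpos (e j • EuclideanSpace.single i (1 : ℝ) - e i • EuclideanSpace.single j (1 : ℝ))
    have h2 : opMatrix T j i = opMatrix T i j := hsymm.apply i j
    simp only [map_sub, map_smul, inner_sub_left, inner_sub_right, inner_smul_left,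
      inner_smul_right, RCLike.conj_to_real] at h1
    simp only [opMatrix, Matrix.of_apply] at h2 ⊢
    rw [h2] at h1
    linarith
  have hsum := Finset.sum_le_sum fun i (_ : i ∈ Finset.univ) =>
    Finset.sum_le_sum fun j (_ : j ∈ Finset.univ) => key i j
  simp only [Finset.sum_add_distrib, ← Finset.mul_sum, ← Finset.sum_mul] at hsum
  rw [← inner_eq_sum_opMatrix, he2] at hsum
  simp only [Matrix.trace, Matrix.diag_apply]
  linarith

lemma hess_eq_of_hasGradientAt {N : ℕ} {φ : Euc N → ℝ} {G : Euc N → Euc N} {x : Euc N}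
    {T : Euc N →L[ℝ] Euc N} (hφ : ∀ y, HasGradientAt φ (G y) y) (hG : HasFDerivAt G T x) :
    hess φ x = opMatrix T := by
  have h1 : fderiv ℝ φ = fun y => innerSL ℝ (G y) := by
    ext y v
    rw [(hφ y).hasFDerivAt.fderiv]
    simp
  have h2 : HasFDerivAt (fun y => innerSL ℝ (G y)) ((innerSL ℝ).comp T) x :=
    (innerSL ℝ).hasFDerivAt.comp x hG
  ext i j
  simp only [hess, opMatrix, Matrix.of_apply]
  rw [iteratedFDeriv_two_apply, h1, h2.fderiv]
  simp

/-- The quadratic polynomial with gradient `p` and Hessian `A` at `x`. -/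
def quadraticAt {E : Type*} [NormedAddCommGroup E] [InnerProductSpace ℝ E] (x p : E)
    (A : E →L[ℝ] E) (y : E) : ℝ :=
  ⟪p, y - x⟫ + 2⁻¹ * ⟪A (y - x), y - x⟫

lemma contDiff_quadraticAt {E : Type*} [NormedAddCommGroup E] [InnerProductSpace ℝ E] (x p : E)
    (A : E →L[ℝ] E) : ContDiff ℝ 2 (quadraticAt x p A) := by
  have h1 : ContDiff ℝ 2 fun y => y - x := by fun_prop
  exact (contDiff_const.inner ℝ h1).add
    (contDiff_const.mul ((A.contDiff.comp h1).inner ℝ h1))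

lemma hasGradientAt_quadraticAt {E : Type*} [NormedAddCommGroup E] [InnerProductSpace ℝ E]
    [CompleteSpace E] (x p : E) {A : E →L[ℝ] E} (hA : ∀ v w, ⟪A v, w⟫ = ⟪v, A w⟫) (y : E) :
    HasGradientAt (quadraticAt x p A) (p + A (y - x)) y := by
  rw [hasGradientAt_iff_hasFDerivAt]
  have h0 : HasFDerivAt (fun y : E => y - x) (ContinuousLinearMap.id ℝ E) y :=
    (hasFDerivAt_id y).sub_const x
  have h1 : HasFDerivAt (fun y : E => A (y - x)) A y := A.hasFDerivAt.comp y h0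
  have h2 := ((hasFDerivAt_const p y).inner ℝ h0).add ((h1.inner ℝ h0).const_mul 2⁻¹)
  refine h2.congr_fderiv ?_
  ext v
  have h3 : ⟪A (y - x), v⟫ = ⟪A v, y - x⟫ := by rw [hA, real_inner_comm]
  simp only [ContinuousLinearMap.comp_apply, add_apply, smul_apply, ContinuousLinearMap.prod_apply,
    fderivInnerCLM_apply, InnerProductSpace.toDual_apply_apply, ContinuousLinearMap.id_apply,
    zero_apply, inner_zero_left, inner_add_left, smul_eq_mul]
  linarith

lemma gradient_quadraticAt {E : Type*} [NormedAddCommGroup E] [InnerProductSpace ℝ E]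
    [CompleteSpace E] (x p : E) {A : E →L[ℝ] E} (hA : ∀ v w, ⟪A v, w⟫ = ⟪v, A w⟫) :
    gradient (quadraticAt x p A) x = p := by
  simpa using (hasGradientAt_quadraticAt x p hA x).gradient

lemma hess_quadraticAt {N : ℕ} (x p : Euc N) {A : Euc N →L[ℝ] Euc N}
    (hA : ∀ v w, ⟪A v, w⟫ = ⟪v, A w⟫) (y : Euc N) :
    hess (quadraticAt x p A) y = opMatrix A :=
  hess_eq_of_hasGradientAt (hasGradientAt_quadraticAt x p hA)
    ((A.hasFDerivAt.comp y ((hasFDerivAt_id y).sub_const x)).const_add p)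

lemma inner_add_smul_id_comm {E : Type*} [NormedAddCommGroup E] [InnerProductSpace ℝ E]
    {X : E →L[ℝ] E} (hX : ∀ v w, ⟪X v, w⟫ = ⟪v, X w⟫) (c : ℝ) (v w : E) :
    ⟪(X + c • ContinuousLinearMap.id ℝ E) v, w⟫ = ⟪v, (X + c • ContinuousLinearMap.id ℝ E) w⟫ := by
  simp [inner_add_left, inner_add_right, inner_smul_left, inner_smul_right, hX]

lemma IsSuperjet.eventually_le_quadraticAt {E : Type*} [NormedAddCommGroup E]
    [InnerProductSpace ℝ E] {u : E → ℝ} {x p : E} {X : E →L[ℝ] E} (hu : IsSuperjet u x p X)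
    {η : ℝ} (hη : 0 < η) :
    ∀ᶠ y in nhds x, u y ≤
      u x + quadraticAt x p (X + (2 * η) • ContinuousLinearMap.id ℝ E) y := by
  have ht : Filter.Tendsto (fun y => y - x) (nhds x) (nhds 0) :=
    Continuous.tendsto' (by fun_prop) _ _ (sub_self x)
  filter_upwards [ht.eventually (hu.2 η hη)] with y hy
  rw [add_sub_cancel] at hy
  simp only [quadraticAt, add_apply, smul_apply,
    ContinuousLinearMap.id_apply, inner_add_left, inner_smul_left, real_inner_self_eq_norm_sq,
    RCLike.conj_to_real]
  linarith

lemma quadraticAt_self {E : Type*} [NormedAddCommGroup E] [InnerProductSpace ℝ E] (x p : E)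
    (A : E →L[ℝ] E) : quadraticAt x p A x = 0 := by
  simp [quadraticAt]

lemma quadraticAt_neg {E : Type*} [NormedAddCommGroup E] [InnerProductSpace ℝ E] (x p : E)
    (A : E →L[ℝ] E) (y : E) : quadraticAt x (-p) (-A) y = -quadraticAt x p A y := by
  simp only [quadraticAt, neg_apply, inner_neg_left]
  ring

lemma ViscSub.le_of_isSuperjet {N : ℕ} {Ω : Set (Euc N)}
    {G : Euc N → Euc N → Matrix (Fin N) (Fin N) ℝ → ℝ} {f u : Euc N → ℝ}
    (hsub : ViscSub Ω G f u) {x p : Euc N} {X : Euc N →L[ℝ] Euc N} (hx : x ∈ Ω)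
    (hu : IsSuperjet u x p X) {η : ℝ} (hη : 0 < η) :
    f x ≤ G x p (opMatrix X + (2 * η) • 1) := by
  have hA := inner_add_smul_id_comm hu.1 (2 * η)
  have h1 := hsub x hx _ (contDiff_quadraticAt x p (X + (2 * η) • ContinuousLinearMap.id ℝ _)) <| by
    refine Filter.Eventually.filter_mono nhdsWithin_le_nhds ?_
    filter_upwards [hu.eventually_le_quadraticAt hη] with y hy
    rw [quadraticAt_self]
    linarith
  rwa [gradient_quadraticAt x p hA, hess_quadraticAt x p hA, opMatrix_add, opMatrix_smul_id] at h1

lemma ViscSuper.le_of_isSuperjet_neg {N : ℕ} {Ω : Set (Euc N)}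
    {G : Euc N → Euc N → Matrix (Fin N) (Fin N) ℝ → ℝ} {f u : Euc N → ℝ}
    (hsup : ViscSuper Ω G f u) {x p : Euc N} {X : Euc N →L[ℝ] Euc N} (hx : x ∈ Ω)
    (hu : IsSuperjet (fun z => -u z) x p X) {η : ℝ} (hη : 0 < η) :
    G x (-p) (-(opMatrix X + (2 * η) • 1)) ≤ f x := by
  have hA := inner_add_smul_id_comm hu.1 (2 * η)
  have hA' : ∀ v w, ⟪(-(X + (2 * η) • ContinuousLinearMap.id ℝ (Euc N))) v, w⟫ =
      ⟪v, (-(X + (2 * η) • ContinuousLinearMap.id ℝ (Euc N))) w⟫ := fun v w => by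
    rw [neg_apply, neg_apply, inner_neg_left,
      inner_neg_right, hA]
  have h1 := hsup x hx _
    (contDiff_quadraticAt x (-p) (-(X + (2 * η) • ContinuousLinearMap.id ℝ _))) <| by
    refine Filter.Eventually.filter_mono nhdsWithin_le_nhds ?_
    filter_upwards [hu.eventually_le_quadraticAt hη] with y hy
    rw [quadraticAt_self, quadraticAt_neg]
    linarith
  rwa [gradient_quadraticAt x _ hA', hess_quadraticAt x _ hA', opMatrix_neg, opMatrix_add,
    opMatrix_smul_id] at h1

/-- The consequence of uniform ellipticity for the matrices given by the theorem on sums. -/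
lemma UnifElliptic.sub_le_of_superjets {N : ℕ} {lam Lam : ℝ} {F : Matrix (Fin N) (Fin N) ℝ → ℝ}
    (hF : UnifElliptic lam Lam F) (hlam : 0 ≤ lam) {X Z : Euc N →L[ℝ] Euc N} {K δ : ℝ} {e : Euc N}
    (hK : 0 ≤ K) (hX : ∀ v w, ⟪X v, w⟫ = ⟪v, X w⟫) (hZ : ∀ v w, ⟪Z v, w⟫ = ⟪v, Z w⟫)
    (he : ‖e‖ = 1) (hle : ∀ ξ, ⟪X ξ, ξ⟫ + ⟪Z ξ, ξ⟫ ≤ K * ‖ξ‖ ^ 2)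
    (hδ : ⟪X e, e⟫ + ⟪Z e, e⟫ ≤ K - δ) :
    F (opMatrix X + (2 * 1 : ℝ) • 1) + lam * δ ≤
      F (-(opMatrix Z + (2 * 1 : ℝ) • 1)) + Lam * ((K + 4) * N) := by
  set T : Euc N →L[ℝ] Euc N := -(X + Z) + K • ContinuousLinearMap.id ℝ _ with hT
  have hTapp : ∀ v, ⟪T v, v⟫ = K * ‖v‖ ^ 2 - (⟪X v, v⟫ + ⟪Z v, v⟫) := by
    intro v
    simp only [hT, add_apply, smul_apply,
      neg_apply, ContinuousLinearMap.id_apply, inner_add_left, inner_smul_left,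
      inner_neg_left, real_inner_self_eq_norm_sq, RCLike.conj_to_real]
    ring
  have hTsymm : ∀ v w, ⟪T v, w⟫ = ⟪v, T w⟫ := inner_add_smul_id_comm (fun v w => by
    simp only [add_apply, neg_apply, inner_add_left,
      inner_add_right, inner_neg_left, inner_neg_right, hX, hZ]) K
  have hTpos : ∀ v, 0 ≤ ⟪T v, v⟫ := fun v => by rw [hTapp]; linarith [hle v]
  have h1 := (hF (opMatrix X + (2 * 1 : ℝ) • 1) (opMatrix T)
    ((opMatrix_isSymm hX).add (Matrix.isSymm_one.smul _)) (opMatrix_posSemidef hTsymm hTpos)).1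
  have h2 := (hF (-(opMatrix Z + (2 * 1 : ℝ) • 1)) ((K + 4) • 1)
    ((opMatrix_isSymm hZ).add (Matrix.isSymm_one.smul _)).neg
    (Matrix.PosSemidef.one.smul (by positivity))).2
  have h3 : δ ≤ (opMatrix T).trace := by
    refine le_trans ?_ (inner_le_trace_opMatrix hTsymm hTpos he)
    rw [hTapp, he]
    linarith
  have h4 : opMatrix X + (2 * 1 : ℝ) • 1 + opMatrix T =
      -(opMatrix Z + (2 * 1 : ℝ) • 1) + (K + 4) • 1 := by
    rw [hT, opMatrix_add, opMatrix_neg, opMatrix_add, opMatrix_smul_id]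
    module
  rw [h4] at h1
  rw [Matrix.trace_smul, Matrix.trace_one, Fintype.card_fin, smul_eq_mul] at h2
  have h5 := mul_le_mul_of_nonneg_left h3 hlam
  linarith

/-- Interior Lipschitz estimate for viscosity solutions, by the Ishii–Lions method. -/
lemma exists_lipschitz_estimate {N : ℕ} {lam Lam : ℝ} {F : Matrix (Fin N) (Fin N) ℝ → ℝ}
    (hF : UnifElliptic lam Lam F) (hlam : 0 < lam) {R C A : ℝ} (hR : 0 < R) (hC : 0 ≤ C)
    (hA : 0 ≤ A) :
    ∃ L s : ℝ, 0 ≤ L ∧ 0 < s ∧ ∀ (Ω : Set (Euc N)) (b : Euc N → Euc N → ℝ) (f u : Euc N → ℝ)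
      (x₀ : Euc N), closedBall x₀ R ⊆ Ω → ContinuousOn u (closedBall x₀ R) →
      (∀ x ∈ closedBall x₀ R, |u x| ≤ C) → (∀ x ∈ closedBall x₀ R, |f x| ≤ A) →
      (∀ x ∈ closedBall x₀ R, ∀ p, |b x p| ≤ A * (1 + ‖p‖)) →
      ViscSol Ω (fun x p M => F M + b x p) f u →
      ∀ y, ‖x₀ - y‖ ≤ s → u x₀ - u y ≤ L * ‖x₀ - y‖ := by
  obtain ⟨K, hK, hKC⟩ : ∃ K, 0 ≤ K ∧ 2 * C < K / 2 * (R / 2) ^ 2 := by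
    refine ⟨16 * C / R ^ 2 + 1, by positivity, ?_⟩
    have : 16 * C / R ^ 2 * R ^ 2 = 16 * C := by field_simp
    nlinarith [pow_pos hR 2]
  obtain ⟨κ, hκ, hκR, hκA⟩ : ∃ κ > 0, (4 * κ)⁻¹ ≤ R / 4 ∧ 2 * A + 1 ≤ lam * (8 * κ) := by
    refine ⟨R⁻¹ + (2 * A + 1) / (8 * lam), by positivity, ?_, ?_⟩
    · rw [inv_le_comm₀ (by positivity) (by positivity)]
      have : 0 ≤ (2 * A + 1) / (8 * lam) := by positivity
      rw [inv_div, div_eq_mul_inv]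
      linarith
    · have : lam * (8 * ((2 * A + 1) / (8 * lam))) = 2 * A + 1 := by field_simp
      have : 0 ≤ lam * (8 * R⁻¹) := by positivity
      linarith
  obtain ⟨L, hL, hLC, hLA⟩ : ∃ L : ℝ, 0 ≤ L ∧ 2 * C < L * (3 / 4 * (4 * κ)⁻¹) ∧
      Lam * ((K + 4) * N) + A * (6 + K * R) < L := by
    set B := Lam * ((K + 4) * N) + A * (6 + K * R)
    refine ⟨32 / 3 * C * κ + κ + |B| + 1, by positivity, ?_, ?_⟩
    · have h1 : 0 ≤ (|B| + 1) * (3 / 4 * (4 * κ)⁻¹) := by positivity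
      have h2 : κ * (4 * κ)⁻¹ = 1 / 4 := by field_simp
      nlinarith
    · have h1 : 0 ≤ 32 / 3 * C * κ := by positivity
      linarith [le_abs_self B]
  refine ⟨L, min (4 * κ)⁻¹ R, hL, lt_min (by positivity) hR, ?_⟩
  intro Ω b f u x₀ hΩ hu hCu hf hb hsol y₁ hy₁
  by_contra hcon
  push Not at hcon
  have hy₁R : y₁ ∈ closedBall x₀ R := by
    rw [mem_closedBall', dist_eq_norm]
    exact hy₁.trans (min_le_right _ _)
  obtain ⟨x, y, p, q, e, X, Z, hx, hy, hX, hZ, hp, hq, he, hle, hδ⟩ :=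
    exists_superjets_of_doubling hR hL hκ hK hu hCu hκR hLC hKC (mem_closedBall_self hR.le) hy₁R
      (hy₁.trans (min_le_left _ _)) (by
        refine lt_of_le_of_lt ?_ hcon
        have : 0 ≤ L * (κ * ‖x₀ - y₁‖ ^ 2) := by positivity
        simp only [doublingPenalty, sub_self, norm_zero]
        linarith)
  have h1 := hsol.1.le_of_isSuperjet (hΩ hx) hX one_pos
  have h2 := hsol.2.le_of_isSuperjet_neg (hΩ hy) hZ one_pos
  have h3 := hF.sub_le_of_superjets hlam.le hK hX.1 hZ.1 he hle hδ
  have h4 := (abs_le.1 (hb x hx p)).2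
  have h5 := (abs_le.1 (hb y hy (-q))).1
  have h6 := (abs_le.1 (hf x hx)).1
  have h7 := (abs_le.1 (hf y hy)).2
  rw [norm_neg] at h5
  have h8 := mul_le_mul_of_nonneg_left hp hA
  have h9 := mul_le_mul_of_nonneg_left hq hA
  have h10 := mul_le_mul_of_nonneg_right hκA hL
  linarith

lemma exists_forall_abs_le_of_tendstoUniformlyOn {X : Type*} [TopologicalSpace X] {K : Set X}
    (hK : IsCompact K) {g : ℕ → X → ℝ} {g' : X → ℝ} (hg : ∀ n, ContinuousOn (g n) K)
    (hlim : TendstoUniformlyOn g g' Filter.atTop K) :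
    ∃ A, 0 ≤ A ∧ ∀ n, ∀ x ∈ K, |g n x| ≤ A := by
  have hbound : ∀ f : X → ℝ, ContinuousOn f K → ∃ B, 0 ≤ B ∧ ∀ x ∈ K, |f x| ≤ B := by
    intro f hf
    obtain ⟨B, hB⟩ := hK.exists_bound_of_continuousOn hf
    exact ⟨|B|, abs_nonneg B, fun x hx => (hB x hx).trans (le_abs_self B)⟩
  obtain ⟨B, hB0, hB⟩ := hbound g' (hlim.continuousOn (Filter.Frequently.of_forall hg))
  choose C hC0 hC using fun n => hbound (g n) (hg n)
  obtain ⟨M, hM⟩ := Filter.eventually_atTop.1 (Metric.tendstoUniformlyOn_iff.1 hlim 1 one_pos)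
  have hsum : 0 ≤ ∑ n ∈ Finset.range M, C n := Finset.sum_nonneg fun n _ => hC0 n
  refine ⟨B + 1 + ∑ n ∈ Finset.range M, C n, by positivity, fun n x hx => ?_⟩
  rcases lt_or_ge n M with h | h
  · have := Finset.single_le_sum (fun i _ => hC0 i) (Finset.mem_range.2 h)
    linarith [hC n x hx]
  · have h1 := hM n h x hx
    rw [dist_comm, Real.dist_eq] at h1
    have h2 := abs_add_le (g n x - g' x) (g' x)
    rw [sub_add_cancel] at h2
    linarith [hB x hx]

open Filter in
/-- The Arzelà–Ascoli theorem on an open subset of a proper metric space. -/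
lemma exists_subseq_tendstoUniformlyOn {E : Type*} [MetricSpace E] [ProperSpace E] {Ω : Set E}
    (hΩ : IsOpen Ω) {f : ℕ → E → ℝ} (hf : ∀ n, ContinuousOn (f n) Ω)
    (hequi : ∀ x ∈ Ω, ∀ ε > 0, ∃ δ > 0, ∀ n, ∀ y ∈ Ω, dist y x < δ → |f n x - f n y| < ε)
    {C : ℝ} (hC : ∀ n, ∀ x ∈ Ω, |f n x| ≤ C) :
    ∃ σ : ℕ → ℕ, StrictMono σ ∧ ∃ g : E → ℝ, ∀ K ⊆ Ω, IsCompact K →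
      TendstoUniformlyOn (fun n => f (σ n)) g atTop K := by
  have : LocallyCompactSpace Ω := hΩ.locallyCompactSpace
  let F : ℕ → C(Ω, ℝ) := fun n => ⟨Ω.domRestrict (f n), (hf n).domRestrict⟩
  have hcov : ⋃₀ {K : Set Ω | IsCompact K} = univ :=
    eq_univ_of_forall fun x => mem_sUnion_of_mem (mem_singleton x) isCompact_singleton
  have : T2Space (UniformOnFun Ω ℝ {K : Set Ω | IsCompact K}) :=
    UniformOnFun.t2Space_of_covering hcov
  have hcomp : IsCompact (closure (range F)) := by
    refine ArzelaAscoli.isCompact_closure_of_isClosedEmbedding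
      (F := fun g : C(Ω, ℝ) => (g : Ω → ℝ)) (𝔖 := {K : Set Ω | IsCompact K}) (fun K hK => hK)
      ContinuousMap.isUniformEmbedding_toUniformOnFunIsCompact.isClosedEmbedding
      (fun K _ => Equicontinuous.equicontinuousOn ?_ K) fun K _ x _ =>
        ⟨Icc (-C) C, isCompact_Icc, ?_⟩
    · intro x
      rw [Metric.equicontinuousAt_iff]
      intro ε hε
      obtain ⟨δ, hδ, h⟩ := hequi x x.2 ε hε
      refine ⟨δ, hδ, ?_⟩
      rintro y hy ⟨-, n, rfl⟩
      exact h n y y.2 hy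
    · rintro - ⟨n, rfl⟩
      exact abs_le.1 (hC n x x.2)
  obtain ⟨g, -, σ, hσ, hlim⟩ := hcomp.tendsto_subseq fun n => subset_closure (mem_range_self n)
  rw [ContinuousMap.tendsto_iff_forall_isCompact_tendstoUniformlyOn] at hlim
  refine ⟨σ, hσ, Function.extend Subtype.val g 0, fun K hK hKc => ?_⟩
  have h1 := hlim (Subtype.val ⁻¹' K) (Topology.IsInducing.subtypeVal.isCompact_preimage' hKc
    (by simpa using hK))
  rw [Metric.tendstoUniformlyOn_iff] at h1 ⊢
  intro ε hε
  filter_upwards [h1 ε hε] with n hn x hx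
  have h2 := hn ⟨x, hK hx⟩ hx
  rwa [← Subtype.val_injective.extend_apply g 0 ⟨x, hK hx⟩] at h2

lemma hess_isSymm {N : ℕ} {φ : Euc N → ℝ} (hφ : ContDiff ℝ 2 φ) (x : Euc N) :
    (hess φ x).IsSymm := by
  have h := hφ.contDiffAt.isSymmSndFDerivAt (x := x) (by simp)
  ext i j
  simp only [hess, Matrix.transpose_apply, Matrix.of_apply, iteratedFDeriv_two_apply]
  exact h.eq _ _

lemma continuous_hess {N : ℕ} {φ : Euc N → ℝ} (hφ : ContDiff ℝ 2 φ) : Continuous (hess φ) := by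
  have h := hφ.continuous_iteratedFDeriv (m := 2) le_rfl
  exact continuous_matrix fun i j =>
    (ContinuousMultilinearMap.apply ℝ (fun _ : Fin 2 => Euc N) ℝ
      ![EuclideanSpace.single i (1 : ℝ), EuclideanSpace.single j (1 : ℝ)]).continuous.comp h

lemma continuous_gradient {E : Type*} [NormedAddCommGroup E] [InnerProductSpace ℝ E]
    [CompleteSpace E] {φ : E → ℝ} (hφ : ContDiff ℝ 2 φ) : Continuous (gradient φ) :=
  (InnerProductSpace.toDual ℝ E).symm.continuous.comp (hφ.continuous_fderiv two_ne_zero)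

lemma hess_add {N : ℕ} {φ ψ : Euc N → ℝ} (hφ : ContDiff ℝ 2 φ) (hψ : ContDiff ℝ 2 ψ) (x : Euc N) :
    hess (fun y => φ y + ψ y) x = hess φ x + hess ψ x := by
  ext i j
  simp only [hess, Matrix.of_apply, Matrix.add_apply]
  rw [fun_iteratedFDeriv_add_apply (hφ.contDiffAt) (hψ.contDiffAt)]
  rfl

lemma hess_neg {N : ℕ} (φ : Euc N → ℝ) (x : Euc N) : hess (-φ) x = -hess φ x := by
  ext i j
  simp only [hess, Matrix.of_apply, Matrix.neg_apply]
  rw [iteratedFDeriv_neg_apply]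
  rfl

lemma gradient_add_of_contDiff {E : Type*} [NormedAddCommGroup E] [InnerProductSpace ℝ E]
    [CompleteSpace E] {φ ψ : E → ℝ} (hφ : ContDiff ℝ 2 φ) (hψ : ContDiff ℝ 2 ψ) (x : E) :
    gradient (fun y => φ y + ψ y) x = gradient φ x + gradient ψ x := by
  simp only [gradient]
  rw [fderiv_fun_add (hφ.differentiable two_ne_zero x) (hψ.differentiable two_ne_zero x), map_add]

lemma gradient_neg_apply {E : Type*} [NormedAddCommGroup E] [InnerProductSpace ℝ E]
    [CompleteSpace E] (φ : E → ℝ) (x : E) : gradient (-φ) x = -gradient φ x := by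
  simp only [gradient]
  rw [fderiv_neg, map_neg]

lemma posSemidef_smul_one_sub {N : ℕ} {D : Matrix (Fin N) (Fin N) ℝ} (hD : D.IsSymm) :
    ((∑ i, ∑ j, |D i j|) • (1 : Matrix (Fin N) (Fin N) ℝ) - D).PosSemidef := by
  refine Matrix.PosSemidef.of_dotProduct_mulVec_nonneg ?_ fun v => ?_
  · rw [Matrix.IsHermitian, Matrix.conjTranspose_eq_transpose_of_trivial]
    exact (Matrix.isSymm_one.smul _).sub hD
  · rw [Matrix.sub_mulVec, Matrix.smul_mulVec, Matrix.one_mulVec, star_trivial, dotProduct_sub,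
      dotProduct_smul, sub_nonneg, smul_eq_mul]
    have hv : ∀ i, v i ^ 2 ≤ v ⬝ᵥ v := fun i => by
      have := Finset.single_le_sum (f := fun k => v k * v k) (fun k _ => mul_self_nonneg (v k))
        (Finset.mem_univ i)
      rw [sq]
      exact this
    simp only [dotProduct, Matrix.mulVec] at hv ⊢
    rw [Finset.sum_mul]
    refine Finset.sum_le_sum fun i _ => ?_
    rw [Finset.sum_mul, Finset.mul_sum]
    refine Finset.sum_le_sum fun j _ => ?_
    have h1 : |v i * v j| ≤ ∑ k, v k * v k := by
      rw [abs_le]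
      constructor <;> nlinarith [hv i, hv j, sq_nonneg (v i + v j), sq_nonneg (v i - v j)]
    calc v i * (D i j * v j) ≤ |v i * (D i j * v j)| := le_abs_self _
      _ = |D i j| * |v i * v j| := by rw [← abs_mul]; congr 1; ring
      _ ≤ _ := mul_le_mul_of_nonneg_left h1 (abs_nonneg _)

lemma UnifElliptic.le_add {N : ℕ} {lam Lam : ℝ} {F : Matrix (Fin N) (Fin N) ℝ → ℝ}
    (hF : UnifElliptic lam Lam F) (hlam : 0 ≤ lam) {M M' : Matrix (Fin N) (Fin N) ℝ}
    (hM : M.IsSymm) (hM' : M'.IsSymm) :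
    F M' ≤ F M + Lam * (N * ∑ i, ∑ j, |(M' - M) i j|) := by
  set τ := ∑ i, ∑ j, |(M' - M) i j| with hτ
  have hτ0 : 0 ≤ τ := Finset.sum_nonneg fun i _ => Finset.sum_nonneg fun j _ => abs_nonneg _
  have hP := posSemidef_smul_one_sub (hM'.sub hM)
  have h1 := (hF M' _ hM' hP).1
  have h2 := (hF M (τ • 1) hM (Matrix.PosSemidef.one.smul hτ0)).2
  have h3 : 0 ≤ lam * Matrix.trace (τ • (1 : Matrix (Fin N) (Fin N) ℝ) - (M' - M)) :=
    mul_nonneg hlam hP.trace_nonneg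
  rw [← hτ, show M' + (τ • 1 - (M' - M)) = M + τ • 1 by abel] at h1
  rw [Matrix.trace_smul, Matrix.trace_one, Fintype.card_fin, smul_eq_mul] at h2
  rw [mul_comm (N : ℝ)]
  linarith

lemma UnifElliptic.tendsto {N : ℕ} {lam Lam : ℝ} {F : Matrix (Fin N) (Fin N) ℝ → ℝ}
    (hF : UnifElliptic lam Lam F) (hlam : 0 ≤ lam) {ι : Type*} {l : Filter ι}
    {M : ι → Matrix (Fin N) (Fin N) ℝ} {M' : Matrix (Fin N) (Fin N) ℝ}
    (hM : ∀ i, (M i).IsSymm) (hM' : M'.IsSymm) (hlim : Filter.Tendsto M l (nhds M')) :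
    Filter.Tendsto (fun i => F (M i)) l (nhds (F M')) := by
  have h1 : Filter.Tendsto (fun k => F M' + Lam * (N * ∑ i, ∑ j, |(M k - M') i j|)) l
      (nhds (F M')) := by
    have hc : Continuous fun A : Matrix (Fin N) (Fin N) ℝ =>
        F M' + Lam * (N * ∑ i, ∑ j, |(A - M') i j|) := by fun_prop
    simpa [Function.comp_def] using (hc.tendsto M').comp hlim
  have h2 : Filter.Tendsto (fun k => F M' - Lam * (N * ∑ i, ∑ j, |(M' - M k) i j|)) l
      (nhds (F M')) := by
    have hc : Continuous fun A : Matrix (Fin N) (Fin N) ℝ =>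
        F M' - Lam * (N * ∑ i, ∑ j, |(M' - A) i j|) := by fun_prop
    simpa [Function.comp_def] using (hc.tendsto M').comp hlim
  refine tendsto_of_tendsto_of_tendsto_of_le_of_le h2 h1 (fun k => ?_) fun k => ?_
  · exact sub_le_iff_le_add.2 (hF.le_add hlam (hM k) hM')
  · exact hF.le_add hlam hM' (hM k)

lemma UnifElliptic.neg {N : ℕ} {lam Lam : ℝ} {F : Matrix (Fin N) (Fin N) ℝ → ℝ}
    (hF : UnifElliptic lam Lam F) : UnifElliptic lam Lam fun M => -F (-M) := by
  intro M P hM hP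
  have hPs : P.IsSymm := by
    have := hP.isHermitian
    rwa [Matrix.IsHermitian, Matrix.conjTranspose_eq_transpose_of_trivial] at this
  have h := hF (-(M + P)) P (hM.add hPs).neg hP
  rw [show -(M + P) + P = -M by abel] at h
  constructor <;> linarith [h.1, h.2]

lemma viscSuper_iff_viscSub_neg {N : ℕ} {Ω : Set (Euc N)}
    {G : Euc N → Euc N → Matrix (Fin N) (Fin N) ℝ → ℝ} {f u : Euc N → ℝ} :
    ViscSuper Ω G f u ↔
      ViscSub Ω (fun x p M => -G x (-p) (-M)) (fun x => -f x) (fun x => -u x) := by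
  constructor
  · intro h x₀ hx₀ φ hφ hmax
    have := h x₀ hx₀ (-φ) hφ.neg (by simpa [add_comm] using hmax.neg)
    rw [gradient_neg_apply, hess_neg] at this
    exact neg_le_neg this
  · intro h x₀ hx₀ φ hφ hmin
    have := h x₀ hx₀ (-φ) hφ.neg (by simpa [neg_add_eq_sub] using hmin.neg)
    simp only [gradient_neg_apply, hess_neg, neg_neg] at this
    exact neg_le_neg_iff.1 this

/-- If `u n` converges uniformly to `v` and `v` has a strict maximum, then maximum points of `u n`
converge to it. -/
lemma tendsto_of_isMaxOn {E : Type*} [NormedAddCommGroup E] {K : Set E} {u : ℕ → E → ℝ}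
    {v : E → ℝ} {x₀ : E} {x : ℕ → E} {η : ℝ} (hη : 0 < η) (hx₀ : x₀ ∈ K)
    (hlim : TendstoUniformlyOn u v Filter.atTop K)
    (hstrict : ∀ y ∈ K, v y ≤ v x₀ - η * ‖y - x₀‖ ^ 2) (hxK : ∀ n, x n ∈ K)
    (hmax : ∀ n, IsMaxOn (u n) K (x n)) : Filter.Tendsto x Filter.atTop (nhds x₀) := by
  rw [Metric.tendsto_nhds]
  intro ρ hρ
  filter_upwards [Metric.tendstoUniformlyOn_iff.1 hlim (η * ρ ^ 2 / 2) (by positivity)] with n hn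
  have h1 := (abs_lt.1 (hn x₀ hx₀)).2
  have h2 := (abs_lt.1 (hn (x n) (hxK n))).1
  have h3 : u n x₀ ≤ u n (x n) := hmax n hx₀
  have h4 := hstrict (x n) (hxK n)
  rw [dist_eq_norm]
  by_contra hcon
  push Not at hcon
  have h5 : η * ρ ^ 2 ≤ η * ‖x n - x₀‖ ^ 2 := by gcongr
  linarith

open Filter in
lemma ViscSub.of_tendsto {N : ℕ} {lam Lam : ℝ} {F : Matrix (Fin N) (Fin N) ℝ → ℝ}
    (hF : UnifElliptic lam Lam F) (hlam : 0 ≤ lam) {Ω : Set (Euc N)} (hΩ : IsOpen Ω)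
    {b : ℕ → Euc N → Euc N → ℝ} {b' : Euc N → Euc N → ℝ} {f u : ℕ → Euc N → ℝ}
    {f' u' : Euc N → ℝ} (hu : ∀ n, ContinuousOn (u n) Ω)
    (hulim : ∀ K ⊆ Ω, IsCompact K → TendstoUniformlyOn u u' atTop K)
    (hflim : ∀ x ∈ Ω, ∀ y : ℕ → Euc N, Tendsto y atTop (nhds x) →
      Tendsto (fun n => f n (y n)) atTop (nhds (f' x)))
    (hblim : ∀ x ∈ Ω, ∀ p, ∀ y q : ℕ → Euc N, Tendsto y atTop (nhds x) →
      Tendsto q atTop (nhds p) → Tendsto (fun n => b n (y n) (q n)) atTop (nhds (b' x p)))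
    (hsub : ∀ n, ViscSub Ω (fun x p M => F M + b n x p) (f n) (u n)) :
    ViscSub Ω (fun x p M => F M + b' x p) f' u' := by
  intro x₀ hx₀ φ hφ hmax
  obtain ⟨r, hr, hrΩ, hrmax⟩ : ∃ r > 0, closedBall x₀ r ⊆ Ω ∧
      ∀ y ∈ closedBall x₀ r, u' y - φ y ≤ u' x₀ - φ x₀ := by
    rw [IsLocalMaxOn, hΩ.nhdsWithin_eq hx₀] at hmax
    obtain ⟨r, hr, h⟩ := Metric.nhds_basis_closedBall.mem_iff.1 (inter_mem (hΩ.mem_nhds hx₀) hmax)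
    exact ⟨r, hr, fun y hy => (h hy).1, fun y hy => (h hy).2⟩
  have key : ∀ η > (0 : ℝ), f' x₀ ≤ F (hess φ x₀ + (2 * η) • 1) + b' x₀ (gradient φ x₀) := by
    intro η hη
    have hA := inner_add_smul_id_comm (E := Euc N) (X := 0) (by simp) (2 * η)
    set q := quadraticAt x₀ 0 (0 + (2 * η) • ContinuousLinearMap.id ℝ (Euc N)) with hq
    have hqc : ContDiff ℝ 2 q := contDiff_quadraticAt _ _ _
    have hqy : ∀ y, q y = η * ‖y - x₀‖ ^ 2 := fun y => by
      simp only [hq, quadraticAt, inner_zero_left, zero_add, smul_apply,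
        ContinuousLinearMap.id_apply, inner_smul_left, real_inner_self_eq_norm_sq,
        RCLike.conj_to_real]
      ring
    set ψ : Euc N → ℝ := fun y => φ y + q y with hψdef
    have hψ : ContDiff ℝ 2 ψ := hφ.add hqc
    have hψg : gradient ψ x₀ = gradient φ x₀ := by
      rw [gradient_add_of_contDiff hφ hqc, gradient_quadraticAt x₀ 0 hA, add_zero]
    have hψh : hess ψ x₀ = hess φ x₀ + (2 * η) • 1 := by
      rw [hess_add hφ hqc, hess_quadraticAt x₀ 0 hA, zero_add, opMatrix_smul_id]
    have hcont : ∀ n, ContinuousOn (fun y => u n y - ψ y) (closedBall x₀ r) := fun n =>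
      ((hu n).mono hrΩ).sub hψ.continuous.continuousOn
    choose x hxK hxmax using fun n => (isCompact_closedBall x₀ r).exists_isMaxOn
      ⟨x₀, mem_closedBall_self hr.le⟩ (hcont n)
    have hlim : Tendsto x atTop (nhds x₀) := by
      refine tendsto_of_isMaxOn (v := fun y => u' y - ψ y) hη (mem_closedBall_self hr.le) ?_ ?_
        hxK hxmax
      · rw [Metric.tendstoUniformlyOn_iff]
        intro ε hε
        filter_upwards [Metric.tendstoUniformlyOn_iff.1
          (hulim _ hrΩ (isCompact_closedBall x₀ r)) ε hε] with n hn y hy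
        simpa using hn y hy
      · intro y hy
        have := hrmax y hy
        simp only [hψdef, hqy, sub_self, norm_zero]
        linarith
    have hlimF : Tendsto (fun n => F (hess ψ (x n)) + b n (x n) (gradient ψ (x n))) atTop
        (nhds (F (hess ψ x₀) + b' x₀ (gradient ψ x₀))) :=
      (hF.tendsto hlam (fun n => hess_isSymm hψ _) (hess_isSymm hψ _)
        (((continuous_hess hψ).tendsto x₀).comp hlim)).add
        (hblim x₀ hx₀ _ _ _ hlim (((continuous_gradient hψ).tendsto x₀).comp hlim))
    have hle := le_of_tendsto_of_tendsto (hflim x₀ hx₀ x hlim) hlimF <| by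
      filter_upwards [hlim.eventually (ball_mem_nhds x₀ hr)] with n hn
      refine hsub n (x n) (hrΩ (hxK n)) ψ hψ ?_
      exact (((hxmax n).isLocalMax
        (mem_of_superset (isOpen_ball.mem_nhds hn) ball_subset_closedBall))).on Ω
    rwa [hψg, hψh] at hle
  have hlim : Tendsto (fun η : ℝ => F (hess φ x₀ + (2 * η) • 1) + b' x₀ (gradient φ x₀))
      (nhdsWithin 0 (Ioi 0)) (nhds (F (hess φ x₀) + b' x₀ (gradient φ x₀))) := by
    refine (hF.tendsto hlam (fun η => (hess_isSymm hφ _).add (Matrix.isSymm_one.smul _))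
      (hess_isSymm hφ _) ?_).add_const _
    refine Tendsto.mono_left (Continuous.tendsto' ?_ _ _ (by simp)) nhdsWithin_le_nhds
    fun_prop
  exact ge_of_tendsto hlim (eventually_mem_nhdsWithin.mono fun η hη => key η hη)

open Filter in
lemma ViscSol.of_tendsto {N : ℕ} {lam Lam : ℝ} {F : Matrix (Fin N) (Fin N) ℝ → ℝ}
    (hF : UnifElliptic lam Lam F) (hlam : 0 ≤ lam) {Ω : Set (Euc N)} (hΩ : IsOpen Ω)
    {b : ℕ → Euc N → Euc N → ℝ} {b' : Euc N → Euc N → ℝ} {f u : ℕ → Euc N → ℝ}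
    {f' u' : Euc N → ℝ} (hu : ∀ n, ContinuousOn (u n) Ω)
    (hulim : ∀ K ⊆ Ω, IsCompact K → TendstoUniformlyOn u u' atTop K)
    (hflim : ∀ x ∈ Ω, ∀ y : ℕ → Euc N, Tendsto y atTop (nhds x) →
      Tendsto (fun n => f n (y n)) atTop (nhds (f' x)))
    (hblim : ∀ x ∈ Ω, ∀ p, ∀ y q : ℕ → Euc N, Tendsto y atTop (nhds x) →
      Tendsto q atTop (nhds p) → Tendsto (fun n => b n (y n) (q n)) atTop (nhds (b' x p)))
    (hsol : ∀ n, ViscSol Ω (fun x p M => F M + b n x p) (f n) (u n)) :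
    ViscSol Ω (fun x p M => F M + b' x p) f' u' := by
  refine ⟨ViscSub.of_tendsto hF hlam hΩ hu hulim hflim hblim fun n => (hsol n).1, ?_⟩
  rw [viscSuper_iff_viscSub_neg]
  simp only [neg_add]
  refine ViscSub.of_tendsto (b := fun n x p => -b n x (-p)) (f := fun n x => -f n x)
    (u := fun n x => -u n x) hF.neg hlam hΩ (fun n => (hu n).neg) (fun K hK hKc => ?_)
    (fun x hx y hy => (hflim x hx y hy).neg)
    (fun x hx p y q hy hq => (hblim x hx _ y _ hy hq.neg).neg) fun n => ?_
  · have := hulim K hK hKc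
    rw [Metric.tendstoUniformlyOn_iff] at this ⊢
    simpa only [dist_neg_neg] using this
  · simpa only [neg_add] using viscSuper_iff_viscSub_neg.1 (hsol n).2

lemma rpow_le_one_add {t β : ℝ} (ht : 0 ≤ t) (hβ : β ∈ Ioc (0 : ℝ) 1) : t ^ β ≤ 1 + t := by
  rcases le_total t 1 with h | h
  · linarith [Real.rpow_le_one ht h hβ.1.le]
  · have := Real.rpow_le_rpow_of_exponent_le h hβ.2
    rw [Real.rpow_one] at this
    linarith

/-- Viscosity solutions of a family of equations with a uniform linear growth in the gradient are
locally equicontinuous. -/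
lemma equicontinuous_of_viscSol {N : ℕ} {lam Lam : ℝ} {F : Matrix (Fin N) (Fin N) ℝ → ℝ}
    (hF : UnifElliptic lam Lam F) (hlam : 0 < lam) {Ω : Set (Euc N)} {R C A : ℝ} {x : Euc N}
    (hR : 0 < R) (hC : 0 ≤ C) (hA : 0 ≤ A) (hΩ : closedBall x (2 * R) ⊆ Ω)
    {b : ℕ → Euc N → Euc N → ℝ} {f u : ℕ → Euc N → ℝ} (hu : ∀ n, ContinuousOn (u n) Ω)
    (hCu : ∀ n, ∀ y ∈ Ω, |u n y| ≤ C) (hf : ∀ n, ∀ y ∈ closedBall x (2 * R), |f n y| ≤ A)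
    (hb : ∀ n, ∀ y ∈ closedBall x (2 * R), ∀ p, |b n y p| ≤ A * (1 + ‖p‖))
    (hsol : ∀ n, ViscSol Ω (fun x p M => F M + b n x p) (f n) (u n)) {ε : ℝ} (hε : 0 < ε) :
    ∃ δ > 0, ∀ n, ∀ y ∈ Ω, dist y x < δ → |u n x - u n y| < ε := by
  obtain ⟨L, s, hL, hs, hest⟩ := exists_lipschitz_estimate hF hlam hR hC hA
  refine ⟨min R (min s (ε / (L + 1))), lt_min hR (lt_min hs (by positivity)), ?_⟩
  intro n y _ hyx
  have hsub : ∀ z, dist z x ≤ R → closedBall z R ⊆ closedBall x (2 * R) := fun z hz =>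
    closedBall_subset_closedBall' (by linarith)
  have hmain : ∀ z, dist z x ≤ R → ∀ w, ‖z - w‖ ≤ s → u n z - u n w ≤ L * ‖z - w‖ :=
    fun z hz => hest Ω (b n) (f n) (u n) z ((hsub z hz).trans hΩ)
      ((hu n).mono ((hsub z hz).trans hΩ)) (fun v hv => hCu n v (hΩ (hsub z hz hv)))
      (fun v hv => hf n v (hsub z hz hv)) (fun v hv => hb n v (hsub z hz hv)) (hsol n)
  have h1 : ‖y - x‖ ≤ s := by
    rw [← dist_eq_norm]
    exact hyx.le.trans ((min_le_right _ _).trans (min_le_left _ _))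
  have h2 : L * ‖y - x‖ < ε := by
    have h3 : ‖y - x‖ < ε / (L + 1) := by
      rw [← dist_eq_norm]
      exact hyx.trans_le ((min_le_right _ _).trans (min_le_right _ _))
    rw [lt_div_iff₀ (by positivity)] at h3
    nlinarith [norm_nonneg (y - x)]
  have h3 := hmain y (hyx.le.trans (min_le_left _ _)) x h1
  have h4 := hmain x (by rw [dist_self]; exact hR.le) y (by rwa [norm_sub_rev])
  rw [norm_sub_rev] at h4
  rw [abs_lt]
  constructor <;> linarith

open Filter in
lemma TendstoLocallyUniformlyOn.comp_tendsto {X Y ι κ : Type*} [TopologicalSpace X]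
    [UniformSpace Y] {g : ι → X → Y} {g' : X → Y} {s : Set X} {l : Filter ι} {l' : Filter κ}
    (hg : TendstoLocallyUniformlyOn g g' l s) {σ : κ → ι} (hσ : Tendsto σ l' l) :
    TendstoLocallyUniformlyOn (fun k => g (σ k)) g' l' s := fun v hv x hx => by
  obtain ⟨t, ht, h⟩ := hg v hv x hx
  exact ⟨t, ht, hσ.eventually h⟩

open Filter in
lemma TendstoLocallyUniformlyOn.tendsto_apply {X Y : Type*} [TopologicalSpace X] [UniformSpace Y]
    {Ω : Set X} (hΩ : IsOpen Ω) {g : ℕ → X → Y} {g' : X → Y} (hg : ∀ n, ContinuousOn (g n) Ω)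
    (hlim : TendstoLocallyUniformlyOn g g' atTop Ω) {x : X} (hx : x ∈ Ω) {y : ℕ → X}
    (hy : Tendsto y atTop (nhds x)) : Tendsto (fun n => g n (y n)) atTop (nhds (g' x)) :=
  hlim.tendsto_comp (hlim.continuousOn (Frequently.of_forall hg) x hx) hx
    (tendsto_nhdsWithin_iff.2 ⟨hy, hy.eventually (hΩ.mem_nhds hx)⟩)

/-- compactness / stability of viscosity solutions of
`F(D²uₙ) + h·∇uₙ + Hₙ(x,∇uₙ) = fₙ`. -/
theorem stability_of_solutions
    (N : ℕ) (lam Lam : ℝ) (Kh : NNReal) (hlam : 0 < lam) (hlL : lam ≤ Lam)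
    (F : Matrix (Fin N) (Fin N) ℝ → ℝ) (hF : UnifElliptic lam Lam F)
    (h : Euc N → Euc N) (hh : LipschitzWith Kh h)
    (fseq : ℕ → Euc N → ℝ) (Hseq : ℕ → Euc N → Euc N → ℝ)
    (finf Hinf : Euc N → ℝ) (ε : ℕ → ℝ) (β₁ β₂ : ℝ)
    (hβ₁ : β₁ ∈ Ioc (0 : ℝ) 1) (hβ₂ : β₂ ∈ Ioc (0 : ℝ) 1)
    (hfc : ∀ n, ContinuousOn (fseq n) (ball 0 1))
    (hHc : ∀ n, ContinuousOn (fun x => Hseq n x 0) (ball 0 1))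
    (hfconv : ∀ K ⊆ ball (0 : Euc N) 1, IsCompact K →
      TendstoUniformlyOn fseq finf Filter.atTop K)
    (hHconv : ∀ K ⊆ ball (0 : Euc N) 1, IsCompact K →
      TendstoUniformlyOn (fun n x => Hseq n x 0) Hinf Filter.atTop K)
    (hε : Filter.Tendsto ε Filter.atTop (nhds 0))
    (hH : ∀ n, ∀ x q : Euc N, |Hseq n x q - Hseq n x 0| ≤ ε n * (‖q‖ ^ β₁ + ‖q‖ ^ β₂))
    (useq : ℕ → Euc N → ℝ) (huc : ∀ n, ContinuousOn (useq n) (ball 0 1))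
    (Cu : ℝ) (hub : ∀ n, ∀ x ∈ ball (0 : Euc N) 1, |useq n x| ≤ Cu)
    (hsol : ∀ n, ViscSol (ball 0 1)
      (fun x p M => F M + ⟪h x, p⟫ + Hseq n x p) (fseq n) (useq n)) :
    ∃ σ : ℕ → ℕ, StrictMono σ ∧ ∃ uinf : Euc N → ℝ,
      (∀ K ⊆ ball (0 : Euc N) 1, IsCompact K →
        TendstoUniformlyOn (fun n => useq (σ n)) uinf Filter.atTop K) ∧
      ViscSol (ball 0 1) (fun x p M => F M + ⟪h x, p⟫ + Hinf x) finf uinf := by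
  have hopen : IsOpen (ball (0 : Euc N) 1) := isOpen_ball
  have hCu : 0 ≤ Cu := (abs_nonneg _).trans (hub 0 0 (mem_ball_self one_pos))
  have hsol' : ∀ n, ViscSol (ball 0 1)
      (fun x p M => F M + (⟪h x, p⟫ + Hseq n x p)) (fseq n) (useq n) := by
    simpa only [add_assoc] using hsol
  have hequi : ∀ x ∈ ball (0 : Euc N) 1, ∀ η > 0, ∃ δ > 0, ∀ n, ∀ y ∈ ball (0 : Euc N) 1,
      dist y x < δ → |useq n x - useq n y| < η := by
    intro x hx η hη
    have hR : 0 < (1 - dist x 0) / 3 := by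
      have := mem_ball.1 hx
      linarith
    set R := (1 - dist x 0) / 3 with hRdef
    have hsub : closedBall x (2 * R) ⊆ ball 0 1 :=
      closedBall_subset_ball' (by linarith)
    have hcomp := isCompact_closedBall x (2 * R)
    obtain ⟨A₁, hA₁, hf⟩ := exists_forall_abs_le_of_tendstoUniformlyOn hcomp
      (fun n => (hfc n).mono hsub) (hfconv _ hsub hcomp)
    obtain ⟨A₂, hA₂, hHb⟩ := exists_forall_abs_le_of_tendstoUniformlyOn hcomp
      (fun n => (hHc n).mono hsub) (hHconv _ hsub hcomp)
    obtain ⟨A₃, hA₃⟩ := hcomp.exists_bound_of_continuousOn hh.continuous.continuousOn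
    obtain ⟨A₄, hA₄⟩ := isBounded_iff_forall_norm_le.1 (Metric.isBounded_range_of_tendsto ε hε)
    have hA₃0 : 0 ≤ A₃ := (norm_nonneg _).trans (hA₃ x (mem_closedBall_self (by positivity)))
    have hA₄0 : 0 ≤ A₄ := (norm_nonneg _).trans (hA₄ _ (mem_range_self 0))
    refine equicontinuous_of_viscSol hF hlam hR hCu
      (A := A₁ + (A₂ + A₃ + 2 * A₄)) (by positivity) hsub huc hub
      (fun n y hy => (hf n y hy).trans (by linarith)) (fun n y hy p => ?_) hsol' hη
    have h1 := (abs_real_inner_le_norm (h y) p).trans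
      (mul_le_mul_of_nonneg_right (hA₃ y hy) (norm_nonneg p))
    have h2 := abs_sub_abs_le_abs_sub (Hseq n y p) (Hseq n y 0)
    have h3 : ε n * (‖p‖ ^ β₁ + ‖p‖ ^ β₂) ≤ A₄ * (2 * (1 + ‖p‖)) := by
      have h4 := rpow_le_one_add (norm_nonneg p) hβ₁
      have h5 := rpow_le_one_add (norm_nonneg p) hβ₂
      have h6 : ε n ≤ A₄ := (le_abs_self _).trans (hA₄ _ (mem_range_self n))
      calc _ ≤ A₄ * (‖p‖ ^ β₁ + ‖p‖ ^ β₂) := by gcongr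
        _ ≤ _ := by gcongr; linarith
    have h7 := abs_add_le ⟪h y, p⟫ (Hseq n y p)
    have h8 := hH n y p
    have h9 := hHb n y hy
    have hp := norm_nonneg p
    nlinarith [mul_nonneg hA₁ hp, mul_nonneg hA₂ hp, mul_nonneg hA₃0 hp]
  obtain ⟨σ, hσ, uinf, hlim⟩ := exists_subseq_tendstoUniformlyOn hopen huc hequi hub
  refine ⟨σ, hσ, uinf, hlim, ?_⟩
  have hfloc := ((tendstoLocallyUniformlyOn_iff_forall_isCompact hopen).2 hfconv).comp_tendsto
    hσ.tendsto_atTop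
  have hHloc := ((tendstoLocallyUniformlyOn_iff_forall_isCompact hopen).2 hHconv).comp_tendsto
    hσ.tendsto_atTop
  simp only [add_assoc]
  refine ViscSol.of_tendsto hF hlam.le hopen (fun n => huc (σ n)) hlim
    (fun x hx y hy => hfloc.tendsto_apply hopen (fun n => hfc (σ n)) hx hy)
    (b := fun n x p => ⟪h x, p⟫ + Hseq (σ n) x p) ?_ fun n => hsol' (σ n)
  intro x hx p y q hy hq
  refine (((hh.continuous.tendsto x).comp hy).inner hq).add ?_
  have h1 := hHloc.tendsto_apply hopen (fun n => hHc (σ n)) hx hy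
  have h2 : Filter.Tendsto (fun n => ε (σ n) * (‖q n‖ ^ β₁ + ‖q n‖ ^ β₂)) Filter.atTop
      (nhds 0) := by
    have h3 := (hε.comp hσ.tendsto_atTop).mul ((hq.norm.rpow_const (Or.inr hβ₁.1.le)).add
      (hq.norm.rpow_const (Or.inr hβ₂.1.le)))
    simpa only [zero_mul, Function.comp_apply] using h3
  have h3 : Filter.Tendsto (fun n => Hseq (σ n) (y n) (q n) - Hseq (σ n) (y n) 0) Filter.atTop
      (nhds 0) := squeeze_zero_norm (fun n => hH (σ n) (y n) (q n)) h2
  simpa only [sub_add_cancel, zero_add] using h3.add h1
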